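/- arXiv:2602.01976 — 4 statements merged into one kernel-verified Lean document; each statement's English description precedes it below -/
import Mathlib

section
/- Ridge perturbation (Lemma B.2): Let Σ, Σ̂ ∈ ℝ^{M×M} be symmetric positive semidefinite matrices, let b, b̂ ∈ ℝ^{M×T}, and let λ > 0. If ‖Σ̂ − Σ‖_op ≤ λ/2 and ‖b̂ − b‖_F ≤ ε_b, then the population and empirical ridge solutions U_λ^⋆ = (Σ + λI)^{−1} b and Û_λ = (Σ̂ + λI)^{−1} b̂ satisfy ‖Û_λ − U_λ^⋆‖_F ≤ (2/λ) ε_b + (2/λ²) ‖b‖_F ‖Σ̂ − Σ‖_op. -/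
open Matrix

/-- Frobenius norm of a real matrix. -/
noncomputable def frobNorm {m n : Type*} [Fintype m] [Fintype n]
    (A : Matrix m n ℝ) : ℝ :=
  Real.sqrt (∑ i, ∑ j, (A i j) ^ 2)

/-- Operator norm (induced by the Euclidean norms) of a real matrix. -/
noncomputable def opNorm {m n : Type*} [Fintype m] [Fintype n] [DecidableEq n]
    (A : Matrix m n ℝ) : ℝ :=
  ‖LinearMap.toContinuousLinearMap (Matrix.toEuclideanLin A)‖

lemma frobNorm_le_of_col {m n k : ℕ} (A : Matrix (Fin m) (Fin k) ℝ) (B : Matrix (Fin n) (Fin k) ℝ)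
    (c : ℝ) (hc : 0 ≤ c)
    (h : ∀ j, ‖WithLp.toLp 2 (fun i => A i j)‖ ≤ c * ‖WithLp.toLp 2 (fun i => B i j)‖) :
    frobNorm A ≤ c * frobNorm B := by
  unfold frobNorm
  rw [Finset.sum_comm, Finset.sum_comm (f := fun i j => (B i j)^2)]
  apply Real.sqrt_le_iff.2
  refine ⟨by positivity, ?_⟩
  rw [mul_pow, Real.sq_sqrt (by positivity), Finset.mul_sum]
  apply Finset.sum_le_sum
  intro j _
  have h1 := pow_le_pow_left₀ (norm_nonneg _) (h j) 2
  rw [mul_pow, EuclideanSpace.real_norm_sq_eq, EuclideanSpace.real_norm_sq_eq] at h1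
  exact h1

lemma frobNorm_sub_le {m n : ℕ} (A B : Matrix (Fin m) (Fin n) ℝ) :
    frobNorm (A - B) ≤ frobNorm A + frobNorm B := by
  letI := @Matrix.frobeniusNormedAddCommGroup (Fin m) (Fin n) ℝ _ _ _
  have key : ∀ C : Matrix (Fin m) (Fin n) ℝ, frobNorm C = ‖C‖ := by
    intro C
    rw [Matrix.frobenius_norm_def, frobNorm, Real.sqrt_eq_rpow]
    simp
  rw [key, key, key]
  exact norm_sub_le A B

lemma frobNorm_mul_le {m k : ℕ} (A : Matrix (Fin m) (Fin m) ℝ) (B : Matrix (Fin m) (Fin k) ℝ) :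
    frobNorm (A * B) ≤ opNorm A * frobNorm B := by
  apply frobNorm_le_of_col _ _ _ (norm_nonneg _)
  intro j
  exact (LinearMap.toContinuousLinearMap (Matrix.toEuclideanLin A)).le_opNorm
    (WithLp.toLp 2 (fun i => B i j))

lemma ridge_coercive {m : ℕ} (S : Matrix (Fin m) (Fin m) ℝ) (hS : S.PosSemidef) (lam : ℝ)
    (v : Fin m → ℝ) :
    lam * ‖WithLp.toLp 2 v‖ ≤
      ‖WithLp.toLp 2 ((S + lam • (1 : Matrix (Fin m) (Fin m) ℝ)) *ᵥ v)‖ := by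
  have h0 : 0 ≤ v ⬝ᵥ (S *ᵥ v) := by simpa using hS.dotProduct_mulVec_nonneg v
  have h1 := real_inner_le_norm (WithLp.toLp 2 v)
    (WithLp.toLp 2 ((S + lam • (1 : Matrix (Fin m) (Fin m) ℝ)) *ᵥ v))
  have h2 : inner ℝ (WithLp.toLp 2 v)
    (WithLp.toLp 2 ((S + lam • (1 : Matrix (Fin m) (Fin m) ℝ)) *ᵥ v))
      = v ⬝ᵥ (S *ᵥ v) + lam * ‖WithLp.toLp 2 v‖ ^ 2 := by
    rw [EuclideanSpace.inner_toLp_toLp, EuclideanSpace.real_norm_sq_eq, dotProduct_comm]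
    simp [add_mulVec, smul_mulVec, dotProduct, sq, mul_add, Finset.sum_add_distrib,
      Finset.mul_sum, mul_left_comm]
  rcases (norm_nonneg (WithLp.toLp 2 v)).eq_or_lt with h | h
  · rw [← h]; simp
  · rw [h2] at h1
    refine le_of_mul_le_mul_left ?_ h
    nlinarith

lemma ridge_det {m : ℕ} (S : Matrix (Fin m) (Fin m) ℝ) (hS : S.PosSemidef) (lam : ℝ)
    (hlam : 0 < lam) : IsUnit (S + lam • (1 : Matrix (Fin m) (Fin m) ℝ)).det := by
  have : (S + lam • (1 : Matrix (Fin m) (Fin m) ℝ)).PosDef :=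
    PosDef.posSemidef_add hS (PosDef.one.smul hlam)
  exact this.det_pos.ne'.isUnit

lemma ridge_inv_bound {m k : ℕ} (S : Matrix (Fin m) (Fin m) ℝ) (hS : S.PosSemidef) (lam : ℝ)
    (hlam : 0 < lam) (b : Matrix (Fin m) (Fin k) ℝ) :
    frobNorm ((S + lam • (1 : Matrix (Fin m) (Fin m) ℝ))⁻¹ * b) ≤ (1 / lam) * frobNorm b := by
  apply frobNorm_le_of_col _ _ _ (by positivity)
  intro j
  set A := S + lam • (1 : Matrix (Fin m) (Fin m) ℝ) with hA
  have h := ridge_coercive S hS lam (fun i => (A⁻¹ * b) i j)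
  rw [← hA] at h
  have e : A *ᵥ (fun i => (A⁻¹ * b) i j) = fun i => b i j := by
    have : A * (A⁻¹ * b) = b := mul_nonsing_inv_cancel_left _ _ (ridge_det S hS lam hlam)
    ext i
    exact congrFun (congrFun this i) j
  rw [e] at h
  rw [one_div, inv_mul_eq_div, le_div_iff₀ hlam]
  linarith

/-- **Ridge perturbation (Lemma B.2).**
If `‖Σ̂ − Σ‖_op ≤ λ/2` and `‖b̂ − b‖_F ≤ ε_b`, then the ridge solutions
`U_λ^⋆ = (Σ + λI)⁻¹ b` and `Û_λ = (Σ̂ + λI)⁻¹ b̂` satisfy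
`‖Û_λ − U_λ^⋆‖_F ≤ (2/λ) ε_b + (2/λ²) ‖b‖_F ‖Σ̂ − Σ‖_op`. -/
theorem ridge_perturbation
    (M T : ℕ) (Sig SigHat : Matrix (Fin M) (Fin M) ℝ)
    (hSig : Sig.PosSemidef) (hSigHat : SigHat.PosSemidef)
    (b bhat : Matrix (Fin M) (Fin T) ℝ)
    (lam εb : ℝ) (hlam : 0 < lam)
    (hop : opNorm (SigHat - Sig) ≤ lam / 2)
    (hb : frobNorm (bhat - b) ≤ εb) :
    frobNorm ((SigHat + lam • (1 : Matrix (Fin M) (Fin M) ℝ))⁻¹ * bhat -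
        (Sig + lam • (1 : Matrix (Fin M) (Fin M) ℝ))⁻¹ * b) ≤
      (2 / lam) * εb + (2 / lam ^ 2) * frobNorm b * opNorm (SigHat - Sig) := by
  have hD := ridge_det SigHat hSigHat lam hlam
  have hD0 := ridge_det Sig hSig lam hlam
  have hB := ridge_inv_bound Sig hSig lam hlam b
  have hX := ridge_inv_bound SigHat hSigHat lam hlam
    ((bhat - b) - (SigHat - Sig) * ((Sig + lam • (1 : Matrix (Fin M) (Fin M) ℝ))⁻¹ * b))
  have e : (SigHat + lam • (1 : Matrix (Fin M) (Fin M) ℝ))⁻¹ * bhat -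
      (Sig + lam • (1 : Matrix (Fin M) (Fin M) ℝ))⁻¹ * b =
      (SigHat + lam • (1 : Matrix (Fin M) (Fin M) ℝ))⁻¹ * ((bhat - b) -
      (SigHat - Sig) * ((Sig + lam • (1 : Matrix (Fin M) (Fin M) ℝ))⁻¹ * b)) := by
    have hs : SigHat - Sig = (SigHat + lam • (1 : Matrix (Fin M) (Fin M) ℝ)) -
      (Sig + lam • (1 : Matrix (Fin M) (Fin M) ℝ)) := by abel
    rw [hs, Matrix.sub_mul, mul_nonsing_inv_cancel_left _ _ hD0, Matrix.mul_sub, Matrix.mul_sub,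
      Matrix.mul_sub, nonsing_inv_mul_cancel_left _ _ hD]
    abel
  rw [← e] at hX
  have h1 := frobNorm_sub_le (bhat - b)
    ((SigHat - Sig) * ((Sig + lam • (1 : Matrix (Fin M) (Fin M) ℝ))⁻¹ * b))
  have h2 := frobNorm_mul_le (SigHat - Sig) ((Sig + lam • (1 : Matrix (Fin M) (Fin M) ℝ))⁻¹ * b)
  have ho : 0 ≤ opNorm (SigHat - Sig) := norm_nonneg _
  have hbn : 0 ≤ frobNorm b := Real.sqrt_nonneg _
  have hε : 0 ≤ εb := (Real.sqrt_nonneg _).trans hb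
  have h3 := mul_le_mul_of_nonneg_left hB ho
  have hl : 0 ≤ 1 / lam := by positivity
  have h4 : frobNorm ((bhat - b) -
      (SigHat - Sig) * ((Sig + lam • (1 : Matrix (Fin M) (Fin M) ℝ))⁻¹ * b)) ≤
      εb + opNorm (SigHat - Sig) * (1 / lam * frobNorm b) := by linarith
  refine (hX.trans (mul_le_mul_of_nonneg_left h4 hl)).trans ?_
  have h5 : 0 ≤ 1 / lam * εb := by positivity
  have h6 : 0 ≤ 1 / lam ^ 2 * frobNorm b * opNorm (SigHat - Sig) := by positivity
  have h7 : (2 / lam) * εb + (2 / lam ^ 2) * frobNorm b * opNorm (SigHat - Sig) -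
      1 / lam * (εb + opNorm (SigHat - Sig) * (1 / lam * frobNorm b)) =
      1 / lam * εb + 1 / lam ^ 2 * frobNorm b * opNorm (SigHat - Sig) := by
    field_simp
    ring
  linarith
end

section
/- Margin-based routing accuracy corollary: Let (Ω, ℱ, P) be a probability space, let X : Ω → ℝ^M and C : Ω → ℝ^T be measurable, suppose ‖X‖₂ ≤ C_φ almost surely for some C_φ > 0 and E‖C‖₂² < ∞. Let λ > 0, define the regularized population risk R(U) = E‖UX − C‖₂² + λ‖U‖_F² for U ∈ ℝ^{T×M}, and let U^⋆ be a global minimizer of R. Let γ > 0 and assume the margin condition: almost surely there exists an index t^⋆ (depending on ω) with (U^⋆X)_{t^⋆} ≥ (U^⋆X)_t + γ for all t ≠ t^⋆. Then for every Û ∈ ℝ^{T×M}, the misrouting probability satisfies P( there exists t̂ ≠ t^⋆ with (ÛX)_{t̂} ≥ (ÛX)_{t^⋆} ) ≤ (8 C_φ² / (λ γ²)) (R(Û) − R(U^⋆)). -/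
open MeasureTheory

/-- Euclidean norm of a real vector. -/
noncomputable def euclNorm {n : Type*} [Fintype n] (v : n → ℝ) : ℝ :=
  Real.sqrt (∑ i, (v i) ^ 2)

lemma euclNorm_sq' {n : Type*} [Fintype n] (v : n → ℝ) : euclNorm v ^ 2 = ∑ i, (v i) ^ 2 :=
  Real.sq_sqrt (Finset.sum_nonneg fun _ _ => sq_nonneg _)

lemma frobNorm_sq' {m n : Type*} [Fintype m] [Fintype n] (A : Matrix m n ℝ) :
    frobNorm A ^ 2 = ∑ i, ∑ j, (A i j) ^ 2 :=
  Real.sq_sqrt (Finset.sum_nonneg fun _ _ => Finset.sum_nonneg fun _ _ => sq_nonneg _)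

lemma mulVec_sq_le {m n : Type*} [Fintype m] [Fintype n] (A : Matrix m n ℝ) (x : n → ℝ) :
    euclNorm (A.mulVec x) ^ 2 ≤ frobNorm A ^ 2 * euclNorm x ^ 2 := by
  rw [euclNorm_sq', euclNorm_sq', frobNorm_sq', Finset.sum_mul]
  refine Finset.sum_le_sum fun i _ => ?_
  exact Finset.sum_mul_sq_le_sq_mul_sq _ _ _

lemma risk_integrable (M T : ℕ) {Ω : Type} [MeasurableSpace Ω]
    (P : Measure Ω) [IsProbabilityMeasure P]
    (X : Ω → Fin M → ℝ) (C : Ω → Fin T → ℝ)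
    (hX : Measurable X) (hC : Measurable C)
    (Cφ : ℝ)
    (hXbdd : ∀ᵐ ω ∂P, euclNorm (X ω) ≤ Cφ)
    (hCint : Integrable (fun ω => euclNorm (C ω) ^ 2) P)
    (U : Matrix (Fin T) (Fin M) ℝ) :
    Integrable (fun ω => euclNorm (U.mulVec (X ω) - C ω) ^ 2) P := by
  have hXj : ∀ j, Measurable fun ω => X ω j := fun j => (measurable_pi_apply j).comp hX
  have hCj : ∀ j, Measurable fun ω => C ω j := fun j => (measurable_pi_apply j).comp hC
  refine Integrable.mono'
    (((integrable_const (frobNorm U ^ 2 * Cφ ^ 2)).add hCint).const_mul 2) ?_ ?_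
  · apply Measurable.aestronglyMeasurable
    simp only [euclNorm_sq', Pi.sub_apply, Matrix.mulVec, dotProduct]
    fun_prop
  · filter_upwards [hXbdd] with ω hω
    have h0 : 0 ≤ euclNorm (X ω) := Real.sqrt_nonneg _
    have h1 := mulVec_sq_le U (X ω)
    have h2 : euclNorm (X ω) ^ 2 ≤ Cφ ^ 2 := by gcongr
    have h3 : frobNorm U ^ 2 * euclNorm (X ω) ^ 2 ≤ frobNorm U ^ 2 * Cφ ^ 2 := by gcongr
    rw [Real.norm_of_nonneg (sq_nonneg _)]
    have h4 : euclNorm (U.mulVec (X ω) - C ω) ^ 2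
        ≤ 2 * (euclNorm (U.mulVec (X ω)) ^ 2 + euclNorm (C ω) ^ 2) := by
      simp only [euclNorm_sq', Pi.sub_apply]
      rw [← Finset.sum_add_distrib, Finset.mul_sum]
      refine Finset.sum_le_sum fun i _ => ?_
      nlinarith [sq_nonneg (U.mulVec (X ω) i + C ω i)]
    simp only [Pi.add_apply]
    linarith

/-- **Margin-based routing accuracy corollary.**
If `U^⋆` minimizes the regularized population risk
`R(U) = E‖UX − C‖₂² + λ‖U‖_F²`, `‖X‖₂ ≤ C_φ` a.s., and a.s. the scores `U^⋆X`
have a `γ`-margin at the index `t^⋆(ω)`, then for every `Û` the misrouting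
probability is at most `(8 C_φ² / (λ γ²)) (R(Û) − R(U^⋆))`. -/
theorem margin_based_routing_accuracy
    (M T : ℕ) {Ω : Type} [MeasurableSpace Ω]
    (P : Measure Ω) [IsProbabilityMeasure P]
    (X : Ω → Fin M → ℝ) (C : Ω → Fin T → ℝ)
    (hX : Measurable X) (hC : Measurable C)
    (Cφ : ℝ) (hCφ : 0 < Cφ)
    (hXbdd : ∀ᵐ ω ∂P, euclNorm (X ω) ≤ Cφ)
    (hCint : Integrable (fun ω => euclNorm (C ω) ^ 2) P)
    (lam : ℝ) (hlam : 0 < lam)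
    (R : Matrix (Fin T) (Fin M) ℝ → ℝ)
    (hR : ∀ U, R U =
      (∫ ω, euclNorm (U.mulVec (X ω) - C ω) ^ 2 ∂P) + lam * frobNorm U ^ 2)
    (Ustar : Matrix (Fin T) (Fin M) ℝ)
    (hmin : ∀ U, R Ustar ≤ R U)
    (γ : ℝ) (hγ : 0 < γ)
    (tstar : Ω → Fin T)
    (hmargin : ∀ᵐ ω ∂P, ∀ t : Fin T, t ≠ tstar ω →
      Ustar.mulVec (X ω) t + γ ≤ Ustar.mulVec (X ω) (tstar ω)) :
    ∀ Uhat : Matrix (Fin T) (Fin M) ℝ,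
      (P {ω | ∃ t : Fin T, t ≠ tstar ω ∧
          Uhat.mulVec (X ω) (tstar ω) ≤ Uhat.mulVec (X ω) t}).toReal ≤
        (8 * Cφ ^ 2 / (lam * γ ^ 2)) * (R Uhat - R Ustar) := by
  intro Uhat
  have hint := risk_integrable M T P X C hX hC Cφ hXbdd hCint
  -- strong convexity at the midpoint
  have hgap : lam / 2 * frobNorm (Uhat - Ustar) ^ 2 ≤ R Uhat - R Ustar := by
    set V : Matrix (Fin T) (Fin M) ℝ := (1 / 2 : ℝ) • (Uhat + Ustar) with hV
    have hm := hmin V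
    have hfrob : frobNorm V ^ 2 = 1 / 2 * frobNorm Uhat ^ 2 + 1 / 2 * frobNorm Ustar ^ 2
        - 1 / 4 * frobNorm (Uhat - Ustar) ^ 2 := by
      simp only [frobNorm_sq', Finset.mul_sum, ← Finset.sum_add_distrib,
        ← Finset.sum_sub_distrib]
      refine Finset.sum_congr rfl fun i _ => Finset.sum_congr rfl fun j _ => ?_
      simp only [hV, Matrix.smul_apply, Matrix.add_apply, Matrix.sub_apply, smul_eq_mul]
      ring
    have hI : (∫ ω, euclNorm (V.mulVec (X ω) - C ω) ^ 2 ∂P) ≤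
        1 / 2 * (∫ ω, euclNorm (Uhat.mulVec (X ω) - C ω) ^ 2 ∂P)
        + 1 / 2 * (∫ ω, euclNorm (Ustar.mulVec (X ω) - C ω) ^ 2 ∂P) := by
      rw [← integral_const_mul, ← integral_const_mul,
        ← integral_add ((hint Uhat).const_mul _) ((hint Ustar).const_mul _)]
      refine integral_mono (hint V)
        (((hint Uhat).const_mul _).add ((hint Ustar).const_mul _)) fun ω => ?_
      simp only [euclNorm_sq', Finset.mul_sum, ← Finset.sum_add_distrib]
      refine Finset.sum_le_sum fun i _ => ?_
      simp only [hV, Matrix.smul_mulVec, Matrix.add_mulVec, Pi.sub_apply, Pi.smul_apply,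
        Pi.add_apply, smul_eq_mul]
      nlinarith [sq_nonneg (Uhat.mulVec (X ω) i - Ustar.mulVec (X ω) i)]
    have h1 := hR V
    have h2 := hR Uhat
    have h3 := hR Ustar
    rw [hfrob] at h1
    linarith
  have hcoef : 0 ≤ 8 * Cφ ^ 2 / (lam * γ ^ 2) := by positivity
  have hmul := mul_le_mul_of_nonneg_left hgap hcoef
  have hnn : 0 ≤ 8 * Cφ ^ 2 / (lam * γ ^ 2) * (lam / 2 * frobNorm (Uhat - Ustar) ^ 2) := by
    positivity
  refine le_trans ?_ hmul
  by_cases hP : P {ω | ∃ t : Fin T, t ≠ tstar ω ∧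
          Uhat.mulVec (X ω) (tstar ω) ≤ Uhat.mulVec (X ω) t} = 0
  · rw [hP]; simpa using hnn
  have hfreq : ∃ᵐ ω ∂P, ∃ t : Fin T, t ≠ tstar ω ∧
          Uhat.mulVec (X ω) (tstar ω) ≤ Uhat.mulVec (X ω) t :=
    frequently_ae_iff.mpr hP
  obtain ⟨ω, ⟨t, ht, hle⟩, hb, hmg⟩ := (hfreq.and_eventually (hXbdd.and hmargin)).exists
  have hmt := hmg t ht
  have h0 : 0 ≤ euclNorm (X ω) := Real.sqrt_nonneg _
  have h1 := mulVec_sq_le (Uhat - Ustar) (X ω)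
  have h2 : euclNorm (X ω) ^ 2 ≤ Cφ ^ 2 := by gcongr
  have h3 : frobNorm (Uhat - Ustar) ^ 2 * euclNorm (X ω) ^ 2
      ≤ frobNorm (Uhat - Ustar) ^ 2 * Cφ ^ 2 := by gcongr
  have h4 : ((Uhat - Ustar).mulVec (X ω) t) ^ 2 + ((Uhat - Ustar).mulVec (X ω) (tstar ω)) ^ 2
      ≤ euclNorm ((Uhat - Ustar).mulVec (X ω)) ^ 2 := by
    rw [euclNorm_sq', ← Finset.sum_pair
      (f := fun i => ((Uhat - Ustar).mulVec (X ω) i) ^ 2) ht]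
    exact Finset.sum_le_sum_of_subset_of_nonneg (Finset.subset_univ _)
      fun _ _ _ => sq_nonneg _
  have h5 : γ ≤ (Uhat - Ustar).mulVec (X ω) t - (Uhat - Ustar).mulVec (X ω) (tstar ω) := by
    simp only [Matrix.sub_mulVec, Pi.sub_apply]
    linarith
  have h6 : γ ^ 2 ≤ 2 * (frobNorm (Uhat - Ustar) ^ 2 * Cφ ^ 2) := by
    have := pow_le_pow_left₀ hγ.le h5 2
    nlinarith [sq_nonneg ((Uhat - Ustar).mulVec (X ω) t
      + (Uhat - Ustar).mulVec (X ω) (tstar ω))]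
  have h7 : 8 * Cφ ^ 2 / (lam * γ ^ 2) * (lam / 2 * frobNorm (Uhat - Ustar) ^ 2)
      = 4 * (frobNorm (Uhat - Ustar) ^ 2 * Cφ ^ 2) / γ ^ 2 := by
    field_simp
    ring
  rw [h7]
  refine le_trans (measureReal_le_one (μ := P)) ?_
  rw [le_div_iff₀ (by positivity)]
  nlinarith [sq_nonneg γ]
end

section
/- TE² drift (bias) bound: Let (V, ‖·‖) be a real normed vector space, let α ∈ (0,1), let K be a positive integer, and let w_0, w_1, …, w_K ∈ V. Define the discounted path length P = Σ_{j=1}^K α^{j−1} ‖w_j − w_{j−1}‖. Then ‖Σ_{k=0}^K (1−α)α^k (w_k − w_0)‖ ≤ α P. -/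
/-- **TE² drift (bias) bound.**
In a real normed space, for `α ∈ (0,1)` and points `w_0,…,w_K` with discounted
path length `P = Σ_{j=1}^K α^{j−1}‖w_j − w_{j−1}‖`, the EMA bias satisfies
`‖Σ_{k=0}^K (1−α)α^k (w_k − w_0)‖ ≤ α P`. -/
theorem te2_drift_bias_bound
    {V : Type*} [NormedAddCommGroup V] [NormedSpace ℝ V]
    (α : ℝ) (hα : α ∈ Set.Ioo (0 : ℝ) 1)
    (K : ℕ) (hK : 0 < K) (w : ℕ → V)
    (P : ℝ) (hP : P = ∑ j ∈ Finset.range K, α ^ j * ‖w (j + 1) - w j‖) :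
    ‖∑ k ∈ Finset.range (K + 1), ((1 - α) * α ^ k) • (w k - w 0)‖ ≤ α * P := by
  obtain ⟨h0, h1⟩ := hα
  have hD : ∀ k, ‖w k - w 0‖ ≤ ∑ j ∈ Finset.range k, ‖w (j + 1) - w j‖ := by
    intro k
    rw [← Finset.sum_range_sub]
    exact norm_sum_le _ _
  have key : ∀ n : ℕ, ∑ k ∈ Finset.range (n + 1),
      ((1 - α) * α ^ k) * ∑ j ∈ Finset.range k, ‖w (j + 1) - w j‖
      = α * (∑ j ∈ Finset.range n, α ^ j * ‖w (j + 1) - w j‖)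
        - α ^ (n + 1) * ∑ j ∈ Finset.range n, ‖w (j + 1) - w j‖ := by
    intro n
    induction n with
    | zero => simp
    | succ n ih =>
      rw [Finset.sum_range_succ, ih, Finset.sum_range_succ (n := n),
        Finset.sum_range_succ (n := n)]
      ring
  have hnn : 0 ≤ α ^ (K + 1) * ∑ j ∈ Finset.range K, ‖w (j + 1) - w j‖ := by positivity
  calc _ ≤ ∑ k ∈ Finset.range (K + 1), ‖((1 - α) * α ^ k) • (w k - w 0)‖ := norm_sum_le _ _
    _ ≤ ∑ k ∈ Finset.range (K + 1),
      ((1 - α) * α ^ k) * ∑ j ∈ Finset.range k, ‖w (j + 1) - w j‖ := by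
        refine Finset.sum_le_sum fun k _ => ?_
        have hc : 0 ≤ (1 - α) * α ^ k := mul_nonneg (by linarith) (by positivity)
        rw [norm_smul, Real.norm_of_nonneg hc]
        exact mul_le_mul_of_nonneg_left (hD k) hc
    _ ≤ α * P := by rw [key, hP]; linarith
end

section
/- Random-feature kernel concentration (Lemma B.1): Let σ : ℝ → ℝ be L_σ-Lipschitz with linear growth |σ(z)| ≤ C₀(1+|z|), let h_1,…,h_N ∈ ℝ^d satisfy ‖h_i‖₂ ≤ H, and define the kernel k(h,h') = E_{r∼N(0,I_d)}[σ(h^⊤r)σ(h'^⊤r)]. Let R ∈ ℝ^{d×M} be a random matrix with i.i.d. standard normal entries, with columns r_1,…,r_M. Then there exists a constant C_rf > 0 depending only on H, L_σ, C₀ such that for every δ ∈ (0,1) and ε ∈ (0,1), if M ≥ C_rf · log(N²/δ)/ε², then with probability at least 1−δ over R, max_{1≤i,j≤N} |(1/M) Σ_{ℓ=1}^M σ(h_i^⊤ r_ℓ) σ(h_j^⊤ r_ℓ) − k(h_i, h_j)| ≤ ε. -/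
open MeasureTheory ProbabilityTheory

/-- The standard Gaussian measure `N(0, I_d)` on `ℝ^d`, as a product of
one-dimensional standard Gaussians. -/
noncomputable def stdGaussian (d : ℕ) : Measure (Fin d → ℝ) :=
  Measure.pi fun _ => gaussianReal 0 1


lemma rf_pdf_eq (z : ℝ) : gaussianPDFReal 0 1 z = (√(2 * Real.pi))⁻¹ * Real.exp (-z ^ 2 / 2) := by
  simp [gaussianPDFReal]

lemma rf_poly_exp (a b x : ℝ) (ha : 0 ≤ a) (hb : 0 ≤ b) :
    (a + b * x ^ 2) * Real.exp (x - x ^ 2 / 2) ≤ 4 * Real.exp 1 * (a + b) := by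
  have h1 : Real.exp (x - x ^ 2 / 2) ≤ Real.exp 1 * Real.exp (-(x ^ 2 / 4)) := by
    rw [← Real.exp_add]
    apply Real.exp_le_exp.2
    nlinarith [sq_nonneg (x / 2 - 1)]
  have h2 : x ^ 2 / 4 * Real.exp (-(x ^ 2 / 4)) ≤ 1 := by
    have h := Real.add_one_le_exp (x ^ 2 / 4)
    rw [Real.exp_neg, ← div_eq_mul_inv, div_le_one (Real.exp_pos _)]
    linarith
  have h3 : Real.exp (-(x ^ 2 / 4)) ≤ 1 := Real.exp_le_one_iff.2 (by nlinarith [sq_nonneg x])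
  have h4 : 0 < Real.exp 1 := Real.exp_pos _
  calc (a + b * x ^ 2) * Real.exp (x - x ^ 2 / 2)
      ≤ (a + b * x ^ 2) * (Real.exp 1 * Real.exp (-(x ^ 2 / 4))) := by gcongr
    _ = Real.exp 1 * (a * Real.exp (-(x ^ 2 / 4)) + 4 * b * (x ^ 2 / 4 * Real.exp (-(x ^ 2 / 4)))) := by ring
    _ ≤ Real.exp 1 * (a * 1 + 4 * b * 1) := by gcongr
    _ ≤ 4 * Real.exp 1 * (a + b) := by nlinarith [mul_nonneg h4.le ha]

lemma rf_tail (F : ℝ → ℝ) (a b t : ℝ) (ha : 0 ≤ a) (hb : 0 ≤ b) (ht : 0 ≤ t)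
    (hF : ∀ z, |F z| ≤ a + b * (z - t) ^ 2) :
    ∫⁻ z in Set.Ici t, ENNReal.ofReal (|F z| * gaussianPDFReal 0 1 z)
      ≤ ENNReal.ofReal (4 * Real.exp 1 * (a + b) * gaussianPDFReal 0 1 t / (1 + t)) := by
  set K := 4 * Real.exp 1 * (a + b) * gaussianPDFReal 0 1 t * Real.exp ((1 + t) * t) with hK
  have hK0 : 0 ≤ K := by
    have := gaussianPDFReal_nonneg 0 1 t
    positivity
  have hpt : ∀ z, |F z| * gaussianPDFReal 0 1 z ≤ K * Real.exp (-(1 + t) * z) := by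
    intro z
    have h1 : gaussianPDFReal 0 1 z = gaussianPDFReal 0 1 t * Real.exp ((1 + t) * t)
        * Real.exp (-(1 + t) * z) * Real.exp ((z - t) - (z - t) ^ 2 / 2) := by
      rw [rf_pdf_eq, rf_pdf_eq]
      simp only [mul_assoc, ← Real.exp_add]
      congr 2
      ring
    have h2 := rf_poly_exp a b (z - t) ha hb
    have hp := gaussianPDFReal_nonneg 0 1 t
    calc |F z| * gaussianPDFReal 0 1 z ≤ (a + b * (z - t) ^ 2) * gaussianPDFReal 0 1 z := by
          gcongr
          · exact gaussianPDFReal_nonneg 0 1 z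
          · exact hF z
      _ = ((a + b * (z - t) ^ 2) * Real.exp ((z - t) - (z - t) ^ 2 / 2)) *
          (gaussianPDFReal 0 1 t * Real.exp ((1 + t) * t) * Real.exp (-(1 + t) * z)) := by
          rw [h1]; ring
      _ ≤ (4 * Real.exp 1 * (a + b)) *
          (gaussianPDFReal 0 1 t * Real.exp ((1 + t) * t) * Real.exp (-(1 + t) * z)) := by
          gcongr
      _ = _ := by rw [hK]; ring
  have hneg : -(1 + t) < 0 := by linarith
  have hint := integrableOn_exp_mul_Ioi hneg t
  calc _ = ∫⁻ z in Set.Ioi t, ENNReal.ofReal (|F z| * gaussianPDFReal 0 1 z) :=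
        (setLIntegral_congr Ioi_ae_eq_Ici).symm
    _ ≤ ∫⁻ z in Set.Ioi t, ENNReal.ofReal (K * Real.exp (-(1 + t) * z)) := by
        exact lintegral_mono fun z => ENNReal.ofReal_le_ofReal (hpt z)
    _ = ENNReal.ofReal (∫ z in Set.Ioi t, K * Real.exp (-(1 + t) * z)) := by
        rw [ofReal_integral_eq_lintegral_ofReal (hint.const_mul K)]
        exact Filter.Eventually.of_forall fun z => by positivity
    _ ≤ _ := by
        apply ENNReal.ofReal_le_ofReal
        rw [integral_const_mul, integral_exp_mul_Ioi hneg, hK]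
        apply le_of_eq
        have : Real.exp (-(1 + t) * t) = (Real.exp ((1 + t) * t))⁻¹ := by
          rw [← Real.exp_neg]; congr 1; ring
        rw [this]
        have h5 := (Real.exp_pos ((1 + t) * t)).ne'
        have : 1 + t ≠ 0 := by linarith
        field_simp

lemma rf_half (F w D : ℝ → ℝ) (hFm : Measurable F) (hDm : Measurable D)
    (hw : ∀ z, 0 < z → ENNReal.ofReal |w z| ≤ ∫⁻ t in Set.Ioc 0 z, ENNReal.ofReal (D t))
    (T : ℝ → ENNReal)
    (hT : ∀ t, 0 < t → ∫⁻ z in Set.Ici t, ENNReal.ofReal (|F z| * gaussianPDFReal 0 1 z) ≤ T t) :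
    ∫⁻ z in Set.Ioi 0, ENNReal.ofReal (|F z| * gaussianPDFReal 0 1 z) * ENNReal.ofReal |w z|
      ≤ ∫⁻ t in Set.Ioi 0, ENNReal.ofReal (D t) * T t := by
  set A : ℝ → ENNReal := fun z => ENNReal.ofReal (|F z| * gaussianPDFReal 0 1 z) with hA
  have hAm : Measurable A := by
    have := measurable_gaussianPDFReal 0 1
    fun_prop
  have hDm' : Measurable fun t => ENNReal.ofReal (D t) := by fun_prop
  calc ∫⁻ z in Set.Ioi 0, A z * ENNReal.ofReal |w z|
      ≤ ∫⁻ z in Set.Ioi 0, A z * ∫⁻ t in Set.Ioc 0 z, ENNReal.ofReal (D t) := by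
        refine setLIntegral_mono' measurableSet_Ioi fun z hz => ?_
        gcongr; exact hw z hz
    _ = ∫⁻ z in Set.Ioi 0, ∫⁻ t in Set.Ioi 0,
          (if t ≤ z then A z * ENNReal.ofReal (D t) else 0) := by
        refine lintegral_congr fun z => ?_
        rw [← lintegral_const_mul _ hDm', ← lintegral_indicator measurableSet_Ioc,
          ← lintegral_indicator measurableSet_Ioi]
        refine lintegral_congr fun t => ?_
        by_cases h1 : 0 < t <;> by_cases h2 : t ≤ z <;> simp [Set.indicator, h1, h2]
    _ = ∫⁻ t in Set.Ioi 0, ∫⁻ z in Set.Ioi 0,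
          (if t ≤ z then A z * ENNReal.ofReal (D t) else 0) := by
        apply lintegral_lintegral_swap
        apply Measurable.aemeasurable
        apply Measurable.ite
        · exact measurableSet_le measurable_snd measurable_fst
        · exact (hAm.comp measurable_fst).mul (hDm'.comp measurable_snd)
        · exact measurable_const
    _ ≤ ∫⁻ t in Set.Ioi 0, ENNReal.ofReal (D t) * T t := by
        refine setLIntegral_mono' measurableSet_Ioi fun t ht => ?_
        calc _ ≤ ∫⁻ z in Set.Ici t, ENNReal.ofReal (D t) * A z := by
              rw [← lintegral_indicator measurableSet_Ici, ← lintegral_indicator measurableSet_Ioi]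
              refine lintegral_mono fun z => ?_
              by_cases h1 : 0 < z <;> by_cases h2 : t ≤ z <;> simp [Set.indicator, h1, h2, mul_comm]
          _ = ENNReal.ofReal (D t) * ∫⁻ z in Set.Ici t, A z := by
              rw [lintegral_const_mul _ hAm]
          _ ≤ _ := by gcongr; exact hT t ht

noncomputable def rfClamp (ε y : ℝ) : ℝ := max (-ε) (min ε y)

lemma rfClamp_lip (ε a b : ℝ) : |rfClamp ε a - rfClamp ε b| ≤ |a - b| := by
  unfold rfClamp
  refine (abs_max_sub_max_le_max _ _ _ _).trans ?_
  refine max_le (by simp) ?_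
  exact (abs_min_sub_min_le_max _ _ _ _).trans (max_le (by simp) le_rfl)

lemma rfClamp_cont (ε : ℝ) : Continuous (rfClamp ε) := by
  unfold rfClamp; fun_prop

lemma rfClamp_abs (ε y : ℝ) (hε : 0 < ε) : |rfClamp ε y| ≤ ε := by
  unfold rfClamp; rw [abs_le]; constructor
  · exact le_max_left _ _
  · exact max_le (by linarith) (min_le_left _ _)

lemma rf_lip_cont {g : ℝ → ℝ} {L : ℝ} (hL : 0 ≤ L) (hg : ∀ x y, |g x - g y| ≤ L * |x - y|) :
    Continuous g := by
  have : LipschitzWith L.toNNReal g := by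
    apply LipschitzWith.of_dist_le_mul
    intro x y
    rw [Real.dist_eq, Real.dist_eq, Real.coe_toNNReal _ hL]
    exact hg x y
  exact this.continuous

lemma rf_ftc (g : ℝ → ℝ) (L ε κ c : ℝ) (hL : 0 ≤ L) (hκ : 0 ≤ κ) (hε : 0 < ε)
    (hg : ∀ x y, |g x - g y| ≤ L * |x - y|) (z : ℝ) (hz : 0 < z) :
    ENNReal.ofReal |rfClamp ε (c + κ * g z ^ 2) - rfClamp ε (c + κ * g 0 ^ 2)|
      ≤ ∫⁻ t in Set.Ioc 0 z, ENNReal.ofReal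
        (if |c + κ * g t ^ 2| ≤ ε then κ * (L * (2 * |g t| + 1)) else 0) := by
  have hgc := rf_lip_cont hL hg
  set v : ℝ → ℝ := fun z => rfClamp ε (c + κ * g z ^ 2) with hv
  have hvd : ∀ x y, |v x - v y| ≤ κ * (L * (|g x + g y|)) * |x - y| := by
    intro x y
    refine (rfClamp_lip _ _ _).trans ?_
    have : c + κ * g x ^ 2 - (c + κ * g y ^ 2) = κ * ((g x - g y) * (g x + g y)) := by ring
    rw [this, abs_mul, abs_mul, abs_of_nonneg hκ]
    calc κ * (|g x - g y| * |g x + g y|) ≤ κ * ((L * |x - y|) * |g x + g y|) := by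
          gcongr; exact hg x y
      _ = _ := by ring
  have hlip : LipschitzOnWith (κ * (L * (2 * (|g 0| + L * z)))).toNNReal v (Set.uIcc 0 z) := by
    apply LipschitzOnWith.of_dist_le_mul
    intro x hx y hy
    rw [Set.uIcc_of_le hz.le] at hx hy
    rw [Real.dist_eq, Real.dist_eq, Real.coe_toNNReal _ (by positivity)]
    refine (hvd x y).trans ?_
    have hb : ∀ x ∈ Set.Icc 0 z, |g x| ≤ |g 0| + L * z := by
      intro x hx
      have h1 := hg x 0
      rw [sub_zero, abs_of_nonneg hx.1] at h1
      have h2 : L * x ≤ L * z := by gcongr; exact hx.2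
      have h3 := abs_sub_abs_le_abs_sub (g x) (g 0)
      linarith
    gcongr
    have := abs_add_le (g x) (g y)
    linarith [hb x hx, hb y hy]
  have hftc := hlip.absolutelyContinuousOnInterval.integral_deriv_eq_sub
  change ENNReal.ofReal |v z - v 0| ≤ _
  rw [← hftc, intervalIntegral.integral_of_le hz.le, ← Real.norm_eq_abs, ofReal_norm]
  refine (enorm_integral_le_lintegral_enorm _).trans ?_
  refine lintegral_mono fun t => ?_
  rw [← ofReal_norm]
  apply ENNReal.ofReal_le_ofReal
  split_ifs with h
  · apply norm_deriv_le_of_lip' (by positivity)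
    have h1 : ∀ᶠ x in nhds t, |g x - g t| < 1 := by
      have h2 : Continuous fun x => |g x - g t| := by fun_prop
      have h3 := h2.tendsto t
      simp only [sub_self, abs_zero] at h3
      exact h3.eventually (gt_mem_nhds one_pos)
    filter_upwards [h1] with x hx
    rw [Real.norm_eq_abs, Real.norm_eq_abs]
    refine (hvd x t).trans ?_
    gcongr
    have h4 : g x + g t = (g x - g t) + 2 * g t := by ring
    rw [h4]
    refine (abs_add_le _ _).trans ?_
    rw [abs_mul, abs_two]
    linarith
  · apply norm_deriv_le_of_lip' le_rfl
    push Not at h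
    have h2 : Continuous fun x => c + κ * g x ^ 2 := by fun_prop
    rcases lt_abs.1 h with h | h
    · have h3 := (h2.tendsto t).eventually (lt_mem_nhds h)
      filter_upwards [h3] with x hx
      simp [hv, rfClamp, min_eq_left hx.le, min_eq_left h.le]
    · have h4 : c + κ * g t ^ 2 < -ε := by linarith
      have h3 := (h2.tendsto t).eventually (gt_mem_nhds h4)
      filter_upwards [h3] with x hx
      have e1 : min ε (c + κ * g x ^ 2) ≤ -ε := (min_le_right _ _).trans hx.le
      have e2 : min ε (c + κ * g t ^ 2) ≤ -ε := (min_le_right _ _).trans h4.le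
      simp [hv, rfClamp, max_eq_left e1, max_eq_left e2]

lemma rf_half2 (g : ℝ → ℝ) (L B m ε κ c : ℝ) (hL : 0 ≤ L) (hB : 0 ≤ B) (hm : 0 ≤ m)
    (hκ : 0 ≤ κ) (hε : 0 < ε)
    (hg : ∀ x y, |g x - g y| ≤ L * |x - y|) (hgB : ∀ z, |g z| ≤ B * (1 + |z|)) :
    ∫⁻ z in Set.Ioi 0, ENNReal.ofReal (|g z ^ 2 - m| * gaussianPDFReal 0 1 z) *
        ENNReal.ofReal |rfClamp ε (c + κ * g z ^ 2) - rfClamp ε (c + κ * g 0 ^ 2)|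
      ≤ ∫⁻ t in Set.Ioi 0, ENNReal.ofReal (gaussianPDFReal 0 1 t *
        (κ * (L * (2 * B + 1) * (4 * Real.exp 1) * (2 + m + 2 * L ^ 2)) *
        (if |c + κ * g t ^ 2| ≤ ε then 1 + g t ^ 2 else 0))) := by
  have hgc := rf_lip_cont hL hg
  refine (rf_half (fun z => g z ^ 2 - m)
    (fun z => rfClamp ε (c + κ * g z ^ 2) - rfClamp ε (c + κ * g 0 ^ 2))
    (fun t => if |c + κ * g t ^ 2| ≤ ε then κ * (L * (2 * |g t| + 1)) else 0) ?_ ?_ ?_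
    (fun t => ENNReal.ofReal (4 * Real.exp 1 * ((2 * g t ^ 2 + m) + 2 * L ^ 2)
      * gaussianPDFReal 0 1 t / (1 + t))) ?_).trans ?_
  · exact (by fun_prop : Continuous fun z => g z ^ 2 - m).measurable
  · apply Measurable.ite
    · exact (isClosed_le (by fun_prop) (by fun_prop)).measurableSet
    · exact (by fun_prop : Continuous _).measurable
    · exact measurable_const
  · intro z hz
    exact rf_ftc g L ε κ c hL hκ hε hg z hz
  · intro t ht
    apply rf_tail _ _ _ _ (by positivity) (by positivity) ht.le
    intro z
    have h1 : g z ^ 2 ≤ 2 * g t ^ 2 + 2 * L ^ 2 * (z - t) ^ 2 := by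
      have h2 := hg z t
      have h3 : (g z - g t) ^ 2 ≤ L ^ 2 * (z - t) ^ 2 := by
        rw [← sq_abs (g z - g t), ← sq_abs (z - t), ← mul_pow]
        gcongr
      nlinarith [sq_nonneg (g z - g t - g t)]
    rw [abs_le]
    constructor <;> nlinarith [sq_nonneg (g z), sq_nonneg (g t), sq_nonneg (L * (z - t))]
  · refine setLIntegral_mono' measurableSet_Ioi fun t ht => ?_
    have ht : 0 < t := ht
    have hp := gaussianPDFReal_nonneg 0 1 t
    rw [← ENNReal.ofReal_mul (by split_ifs <;> positivity)]
    apply ENNReal.ofReal_le_ofReal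
    split_ifs with h
    · have h1 : (2 * |g t| + 1) / (1 + t) ≤ 2 * B + 1 := by
        rw [div_le_iff₀ (by linarith)]
        have := hgB t
        rw [abs_of_pos ht] at this
        nlinarith
      have h2 : (2 * g t ^ 2 + m) + 2 * L ^ 2 ≤ (2 + m + 2 * L ^ 2) * (1 + g t ^ 2) := by
        nlinarith [sq_nonneg (g t), mul_nonneg hm (sq_nonneg (g t)), sq_nonneg (L * g t)]
      calc _ = gaussianPDFReal 0 1 t * (κ * (L * ((2 * |g t| + 1) / (1 + t)) * (4 * Real.exp 1)
            * ((2 * g t ^ 2 + m) + 2 * L ^ 2))) := by ring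
        _ ≤ gaussianPDFReal 0 1 t * (κ * (L * (2 * B + 1) * (4 * Real.exp 1)
            * ((2 + m + 2 * L ^ 2) * (1 + g t ^ 2)))) := by gcongr
        _ = _ := by ring
    · simp

lemma rf_lint_split (Ψ : ℝ → ENNReal) (hΨ : Measurable Ψ) :
    ∫⁻ z, Ψ z = (∫⁻ z in Set.Ioi 0, Ψ z) + ∫⁻ z in Set.Ioi 0, Ψ (-z) := by
  rw [← lintegral_add_compl Ψ (measurableSet_Ioi (a := (0:ℝ)))]
  congr 1
  have h := (Measure.measurePreserving_neg (volume : Measure ℝ)).setLIntegral_comp_preimage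
    (measurableSet_Iio (a := (0:ℝ))) hΨ
  have e : (Neg.neg ⁻¹' (Set.Iio 0) : Set ℝ) = Set.Ioi 0 := by ext; simp
  rw [e] at h
  rw [h, Set.compl_Ioi]
  exact (setLIntegral_congr Iio_ae_eq_Iic).symm

lemma rf_cov1d (g : ℝ → ℝ) (L B ε κ c : ℝ) (hL : 0 ≤ L) (hB : 0 ≤ B)
    (hκ : 0 ≤ κ) (hε : 0 < ε)
    (hg : ∀ x y, |g x - g y| ≤ L * |x - y|) (hgB : ∀ z, |g z| ≤ B * (1 + |z|))
    (m : ℝ) (hm : m = ∫ z, g z ^ 2 ∂(gaussianReal 0 1))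
    (hint : Integrable (fun z => g z ^ 2) (gaussianReal 0 1)) :
    ∫ z, (g z ^ 2 - m) * rfClamp ε (c + κ * g z ^ 2) ∂(gaussianReal 0 1)
      ≤ ∫ z, (κ * (L * (2 * B + 1) * (4 * Real.exp 1) * (2 + m + 2 * L ^ 2))) *
        (if |c + κ * g z ^ 2| ≤ ε then 1 + g z ^ 2 else 0) ∂(gaussianReal 0 1) := by
  have hgc := rf_lip_cont hL hg
  have hm0 : 0 ≤ m := by rw [hm]; exact integral_nonneg fun z => sq_nonneg _
  set C := κ * (L * (2 * B + 1) * (4 * Real.exp 1) * (2 + m + 2 * L ^ 2)) with hC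
  have hC0 : 0 ≤ C := by positivity
  have hpm := measurable_gaussianPDFReal 0 1
  have hcc := rfClamp_cont ε
  set R : ℝ → ℝ := fun z => if |c + κ * g z ^ 2| ≤ ε then 1 + g z ^ 2 else 0 with hR
  have hRm : Measurable R := by
    apply Measurable.ite
    · exact (isClosed_le (by fun_prop) (by fun_prop)).measurableSet
    · exact (by fun_prop : Continuous _).measurable
    · exact measurable_const
  have hR0 : ∀ z, 0 ≤ R z := fun z => by simp only [hR]; split_ifs <;> positivity
  have hRi : Integrable R (gaussianReal 0 1) := by
    refine Integrable.mono' ((integrable_const 1).add hint) hRm.aestronglyMeasurable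
      (Filter.Eventually.of_forall fun z => ?_)
    rw [Real.norm_of_nonneg (hR0 z)]
    simp only [hR, Pi.add_apply]
    split_ifs
    · exact le_rfl
    · positivity
  have hi1 : Integrable (fun z => (g z ^ 2 - m) * rfClamp ε (c + κ * g z ^ 2)) (gaussianReal 0 1) := by
    refine (hint.sub (integrable_const m)).mul_bdd (c := ε) ?_ ?_
    · exact (by fun_prop : Continuous _).aestronglyMeasurable
    · exact Filter.Eventually.of_forall fun z => rfClamp_abs _ _ hε
  have hz : ∫ z, (g z ^ 2 - m) ∂(gaussianReal 0 1) = 0 := by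
    rw [integral_sub hint (integrable_const m)]; simp [hm]
  set v0 := rfClamp ε (c + κ * g 0 ^ 2) with hv0
  have e1 : ∫ z, (g z ^ 2 - m) * rfClamp ε (c + κ * g z ^ 2) ∂(gaussianReal 0 1)
      = ∫ z, (g z ^ 2 - m) * (rfClamp ε (c + κ * g z ^ 2) - v0) ∂(gaussianReal 0 1) := by
    simp_rw [mul_sub]
    have hi3 : Integrable (fun z => (g z ^ 2 - m) * v0) (gaussianReal 0 1) :=
      (hint.sub (integrable_const m)).mul_const v0
    rw [integral_sub hi1 hi3, integral_mul_const, hz]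
    simp
  have key : ‖∫ z, (g z ^ 2 - m) * (rfClamp ε (c + κ * g z ^ 2) - v0) ∂(gaussianReal 0 1)‖ₑ
      ≤ ENNReal.ofReal (∫ z, C * R z ∂(gaussianReal 0 1)) := by
    rw [integral_gaussianReal_eq_integral_smul one_ne_zero,
      integral_gaussianReal_eq_integral_smul one_ne_zero]
    refine (enorm_integral_le_lintegral_enorm _).trans ?_
    have hi2 : Integrable (fun z => gaussianPDFReal 0 1 z • (C * R z)) := by
      have h := hRi.const_mul C
      rw [gaussianReal_of_var_ne_zero _ one_ne_zero,
        integrable_withDensity_iff_integrable_smul' (measurable_gaussianPDF _ _)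
        (ae_of_all _ fun _ ↦ gaussianPDF_lt_top)] at h
      simpa using h
    rw [ofReal_integral_eq_lintegral_ofReal hi2 (Filter.Eventually.of_forall fun z =>
      mul_nonneg (gaussianPDFReal_nonneg 0 1 z) (mul_nonneg hC0 (hR0 z)))]
    calc _ = ∫⁻ z, ENNReal.ofReal (|g z ^ 2 - m| * gaussianPDFReal 0 1 z) *
        ENNReal.ofReal |rfClamp ε (c + κ * g z ^ 2) - v0| := by
          refine lintegral_congr fun z => ?_
          have hp := gaussianPDFReal_nonneg 0 1 z
          rw [← ENNReal.ofReal_mul (by positivity), ← ofReal_norm, smul_eq_mul, norm_mul,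
            norm_mul, Real.norm_of_nonneg hp, Real.norm_eq_abs, Real.norm_eq_abs]
          congr 1; ring
      _ ≤ _ := by
          rw [rf_lint_split _ (by fun_prop), rf_lint_split _ (by fun_prop)]
          have hev : ∀ z, gaussianPDFReal 0 1 (-z) = gaussianPDFReal 0 1 z := by
            intro z; simp [rf_pdf_eq]
          have hA := rf_half2 g L B m ε κ c hL hB hm0 hκ hε hg hgB
          have hB' := rf_half2 (fun z => g (-z)) L B m ε κ c hL hB hm0 hκ hε
            (fun x y => (hg _ _).trans (by rw [← abs_neg (x - y)]; apply le_of_eq; congr 2; ring))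
            (fun z => by simpa using hgB (-z))
          simp only [neg_zero] at hB'
          simp only [hev, smul_eq_mul]
          exact add_le_add hA hB'
  rw [e1]
  have h0 : 0 ≤ ∫ z, C * R z ∂(gaussianReal 0 1) :=
    integral_nonneg fun z => mul_nonneg hC0 (hR0 z)
  rw [← ofReal_norm, ENNReal.ofReal_le_ofReal_iff h0] at key
  exact (le_abs_self _).trans key

lemma rf_fubini_le {n : ℕ} (γ : Measure ℝ) [IsProbabilityMeasure γ] (l : Fin (n + 1))
    (P Q : (Fin (n + 1) → ℝ) → ℝ)
    (hP : Integrable P (Measure.pi fun _ => γ)) (hQ : Integrable Q (Measure.pi fun _ => γ))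
    (h : ∀ w : Fin n → ℝ, ∫ x, P (l.insertNth x w) ∂γ ≤ ∫ x, Q (l.insertNth x w) ∂γ) :
    ∫ z, P z ∂(Measure.pi fun _ => γ) ≤ ∫ z, Q z ∂(Measure.pi fun _ => γ) := by
  have mp := (measurePreserving_piFinSuccAbove (fun _ : Fin (n + 1) => γ) l).symm
  have emb := (MeasurableEquiv.piFinSuccAbove (fun _ : Fin (n + 1) => ℝ) l).symm.measurableEmbedding
  have hP' := (mp.integrable_comp_emb emb).2 hP
  have hQ' := (mp.integrable_comp_emb emb).2 hQ
  rw [← mp.integral_comp emb P, ← mp.integral_comp emb Q]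
  refine (integral_prod_symm _ hP').trans_le (le_trans ?_ (integral_prod_symm _ hQ').ge)
  refine integral_mono hP'.integral_prod_right hQ'.integral_prod_right fun w => ?_
  exact h w

lemma rf_gap (g : ℝ → ℝ) (L B ε : ℝ) (hL : 0 ≤ L) (hB : 0 ≤ B) (hε : 0 < ε)
    (hg : ∀ x y, |g x - g y| ≤ L * |x - y|) (hgB : ∀ z, |g z| ≤ B * (1 + |z|))
    (m : ℝ) (hm : m = ∫ z, g z ^ 2 ∂(gaussianReal 0 1))
    (hint : Integrable (fun z => g z ^ 2) (gaussianReal 0 1)) (n : ℕ) :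
    ε ^ 2 * (1 - (Measure.pi fun _ : Fin (n + 1) => gaussianReal 0 1).real
      {z | |1 / ((n + 1 : ℕ) : ℝ) * ∑ l, g (z l) ^ 2 - m| ≤ ε}) ≤
    (L * (2 * B + 1) * (4 * Real.exp 1) * (2 + m + 2 * L ^ 2)) * (1 + m + ε) / ((n + 1 : ℕ) : ℝ) *
    (Measure.pi fun _ : Fin (n + 1) => gaussianReal 0 1).real
      {z | |1 / ((n + 1 : ℕ) : ℝ) * ∑ l, g (z l) ^ 2 - m| ≤ ε} := by
  have hgc := rf_lip_cont hL hg
  have hcc := rfClamp_cont ε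
  have hm0 : 0 ≤ m := by rw [hm]; exact integral_nonneg fun z => sq_nonneg _
  set C := L * (2 * B + 1) * (4 * Real.exp 1) * (2 + m + 2 * L ^ 2) with hC
  have hC0 : 0 ≤ C := by positivity
  set μ := Measure.pi fun _ : Fin (n + 1) => gaussianReal 0 1 with hμ
  set M : ℝ := ((n + 1 : ℕ) : ℝ) with hM
  have hMpos : 0 < M := by rw [hM]; positivity
  set Y : (Fin (n + 1) → ℝ) → ℝ := fun z => 1 / M * ∑ l, g (z l) ^ 2 - m with hY
  set S := {z | |Y z| ≤ ε} with hS
  have hYc : Continuous Y := by fun_prop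
  have hSm : MeasurableSet S := (isClosed_le (by fun_prop) (by fun_prop)).measurableSet
  have hil : ∀ l, Integrable (fun z : Fin (n + 1) → ℝ => g (z l) ^ 2) μ := fun l =>
    (measurePreserving_eval (fun _ : Fin (n + 1) => gaussianReal 0 1) l).integrable_comp_of_integrable hint
  have hiP : ∀ l, Integrable (fun z : Fin (n + 1) → ℝ => (g (z l) ^ 2 - m) * rfClamp ε (Y z)) μ := by
    intro l
    refine ((hil l).sub (integrable_const m)).mul_bdd (c := ε) ?_ ?_
    · exact (by fun_prop : Continuous _).aestronglyMeasurable
    · exact Filter.Eventually.of_forall fun z => rfClamp_abs _ _ hε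
  have hiQ : ∀ l, Integrable (fun z : Fin (n + 1) → ℝ => (1 / M * C) *
      (if |Y z| ≤ ε then 1 + g (z l) ^ 2 else 0)) μ := by
    intro l
    apply Integrable.const_mul
    have := ((integrable_const (1 : ℝ)).add (hil l)).indicator hSm
    exact this
  -- one coordinate
  have h1 : ∀ l, ∫ z, (g (z l) ^ 2 - m) * rfClamp ε (Y z) ∂μ ≤
      ∫ z, (1 / M * C) * (if |Y z| ≤ ε then 1 + g (z l) ^ 2 else 0) ∂μ := by
    intro l
    apply rf_fubini_le (gaussianReal 0 1) l _ _ (hiP l) (hiQ l)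
    intro w
    have hYw : ∀ x, Y (l.insertNth x w) = (1 / M * ∑ j, g (w j) ^ 2 - m) + 1 / M * g x ^ 2 := by
      intro x
      simp only [hY, Fin.sum_univ_succAbove _ l, Fin.insertNth_apply_same,
        Fin.insertNth_apply_succAbove]
      ring
    simp only [hYw, Fin.insertNth_apply_same]
    exact rf_cov1d g L B ε (1 / M) _ hL hB (by positivity) hε hg hgB m hm hint
  -- sum
  have h2 : ∫ z, Y z * rfClamp ε (Y z) ∂μ ≤ C * (1 + m + ε) / M * μ.real S := by
    have e1 : ∀ z, Y z * rfClamp ε (Y z) =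
        1 / M * ∑ l, (g (z l) ^ 2 - m) * rfClamp ε (Y z) := by
      intro z
      rw [← Finset.sum_mul, Finset.sum_sub_distrib, ← mul_assoc, mul_sub]
      congr 1
      simp only [hY, Finset.sum_const, Finset.card_univ, Fintype.card_fin, nsmul_eq_mul]
      rw [← hM]
      field_simp
    simp_rw [e1]
    rw [integral_const_mul, integral_finsetSum _ (fun l _ => hiP l)]
    calc _ ≤ 1 / M * ∑ l, ∫ z, (1 / M * C) * (if |Y z| ≤ ε then 1 + g (z l) ^ 2 else 0) ∂μ := by
          exact mul_le_mul_of_nonneg_left (Finset.sum_le_sum fun l _ => h1 l) (by positivity)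
      _ = ∫ z, S.indicator (fun z => C / M * (1 + m + Y z)) z ∂μ := by
          rw [← integral_finsetSum _ (fun l _ => hiQ l), ← integral_const_mul]
          congr 1; ext z
          by_cases hz : |Y z| ≤ ε
          · have hz' : z ∈ S := hz
            rw [Set.indicator_of_mem hz']
            simp only [hz, if_true]
            rw [← Finset.mul_sum, Finset.sum_add_distrib]
            simp only [hY, Finset.sum_const, Finset.card_univ, Fintype.card_fin, nsmul_eq_mul]
            rw [← hM]
            field_simp
            ring
          · have hz' : z ∉ S := hz
            rw [Set.indicator_of_notMem hz']
            simp [hz]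
      _ ≤ ∫ z, S.indicator (fun z => C / M * (1 + m + ε)) z ∂μ := by
          have hYi : Integrable Y μ :=
            ((integrable_finsetSum _ (fun l _ => hil l)).const_mul (1 / M)).sub (integrable_const m)
          refine integral_mono ?_ ((integrable_const _).indicator hSm) fun z => ?_
          · exact (((integrable_const (1 + m)).add hYi).const_mul (C / M)).indicator hSm
          · refine Set.indicator_le_indicator' fun hz => ?_
            have hz' : |Y z| ≤ ε := hz
            have := (abs_le.1 hz').2
            gcongr
      _ = _ := by
          rw [integral_indicator hSm, setIntegral_const, smul_eq_mul]; ring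
  have h3 : ε ^ 2 * (1 - μ.real S) ≤ ∫ z, Y z * rfClamp ε (Y z) ∂μ := by
    rw [← probReal_compl_eq_one_sub hSm]
    have e : ε ^ 2 * μ.real Sᶜ = ∫ z, Sᶜ.indicator (fun _ => ε ^ 2) z ∂μ := by
      rw [integral_indicator hSm.compl, setIntegral_const, smul_eq_mul]; ring
    rw [e]
    refine integral_mono ((integrable_const _).indicator hSm.compl) ?_ fun z => ?_
    · have hYi : Integrable Y μ :=
        ((integrable_finsetSum _ (fun l _ => hil l)).const_mul (1 / M)).sub (integrable_const m)
      refine hYi.mul_bdd (c := ε) ?_ ?_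
      · exact (by fun_prop : Continuous _).aestronglyMeasurable
      · exact Filter.Eventually.of_forall fun z => rfClamp_abs _ _ hε
    · have hnn : 0 ≤ Y z * rfClamp ε (Y z) := by
        unfold rfClamp
        rcases le_total 0 (Y z) with h | h
        · exact mul_nonneg h (le_max_of_le_right (le_min hε.le h))
        · refine mul_nonneg_of_nonpos_of_nonpos h (max_le (by linarith) ((min_le_right _ _).trans h))
      by_cases hz : z ∈ S
      · simpa [hz] using hnn
      · simp only [Set.mem_compl_iff, hz, not_false_eq_true, Set.indicator_of_mem]
        have hz' : ε < |Y z| := not_le.1 hz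
        unfold rfClamp
        rcases lt_abs.1 hz' with h | h
        · rw [min_eq_left h.le, max_eq_right (by linarith)]; nlinarith
        · rw [max_eq_left ((min_le_right _ _).trans (by linarith))]; nlinarith
  exact h3.trans h2

lemma rf_exp_le (x : ℝ) : Real.exp x ≤ 1 + x + x ^ 2 * Real.exp |x| := by
  have h := Complex.norm_exp_sub_sum_le_norm_mul_exp (x : ℂ) 2
  simp only [Finset.sum_range_succ, Finset.sum_range_zero, pow_zero, Nat.factorial, pow_one] at h
  norm_num at h
  have e : Complex.exp x - (1 + x) = ((Real.exp x - (1 + x) : ℝ) : ℂ) := by push_cast; ring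
  rw [e, Complex.norm_real, Real.norm_eq_abs] at h
  have := (abs_le.1 h).2
  linarith

lemma rf_le_exp (a y : ℝ) (ha : 0 < a) : y ≤ Real.exp (a * y) / a := by
  rw [le_div_iff₀ ha]
  have := Real.add_one_le_exp (a * y)
  linarith

lemma rf_mgf {Ω : Type*} [MeasurableSpace Ω] (ν : Measure Ω) [IsProbabilityMeasure ν] (W : Ω → ℝ)
    (hW : Measurable W) (a K θ : ℝ) (ha : 0 < a) (hθ : |θ| ≤ a / 2)
    (hi : Integrable (fun ω => Real.exp (a * |W ω|)) ν) (hK : ∫ ω, Real.exp (a * |W ω|) ∂ν ≤ K)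
    (hWi : Integrable W ν) (h0 : ∫ ω, W ω ∂ν = 0) :
    Integrable (fun ω => Real.exp (θ * W ω)) ν ∧
      ∫ ω, Real.exp (θ * W ω) ∂ν ≤ Real.exp (8 * K / a ^ 2 * θ ^ 2) := by
  have hint : Integrable (fun ω => Real.exp (θ * W ω)) ν := by
    refine hi.mono' (by fun_prop) (Filter.Eventually.of_forall fun ω => ?_)
    rw [Real.norm_of_nonneg (Real.exp_pos _).le]
    apply Real.exp_le_exp.2
    refine (le_abs_self _).trans ?_
    rw [abs_mul]
    gcongr
    linarith
  refine ⟨hint, ?_⟩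
  have hpt : ∀ ω, Real.exp (θ * W ω) ≤ 1 + θ * W ω + 8 / a ^ 2 * θ ^ 2 * Real.exp (a * |W ω|) := by
    intro ω
    refine (rf_exp_le _).trans ?_
    have h1 : W ω ^ 2 ≤ 8 / a ^ 2 * Real.exp (a / 2 * |W ω|) := by
      have h2 := Real.quadratic_le_exp_of_nonneg (x := a / 2 * |W ω|) (by positivity)
      have h3 : (a / 2 * |W ω|) ^ 2 / 2 ≤ Real.exp (a / 2 * |W ω|) := by
        have : 0 ≤ a / 2 * |W ω| := by positivity
        linarith
      rw [mul_pow, sq_abs] at h3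
      rw [div_mul_eq_mul_div, le_div_iff₀ (by positivity)]
      nlinarith
    have h2 : Real.exp |θ * W ω| ≤ Real.exp (a / 2 * |W ω|) := by
      apply Real.exp_le_exp.2
      rw [abs_mul]; gcongr
    have : (θ * W ω) ^ 2 * Real.exp |θ * W ω| ≤ 8 / a ^ 2 * θ ^ 2 * Real.exp (a * |W ω|) := by
      calc (θ * W ω) ^ 2 * Real.exp |θ * W ω|
          = θ ^ 2 * W ω ^ 2 * Real.exp |θ * W ω| := by ring
        _ ≤ θ ^ 2 * (8 / a ^ 2 * Real.exp (a / 2 * |W ω|)) * Real.exp (a / 2 * |W ω|) := by gcongr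
        _ = 8 / a ^ 2 * θ ^ 2 * (Real.exp (a / 2 * |W ω|) * Real.exp (a / 2 * |W ω|)) := by ring
        _ = _ := by rw [← Real.exp_add]; congr 2; ring
    linarith
  have hi1 : Integrable (fun ω => 1 + θ * W ω) ν := (integrable_const 1).add (hWi.const_mul θ)
  have hi2 : Integrable (fun ω => 8 / a ^ 2 * θ ^ 2 * Real.exp (a * |W ω|)) ν := hi.const_mul _
  calc ∫ ω, Real.exp (θ * W ω) ∂ν
      ≤ ∫ ω, (1 + θ * W ω + 8 / a ^ 2 * θ ^ 2 * Real.exp (a * |W ω|)) ∂ν :=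
        integral_mono hint (hi1.add hi2) hpt
    _ = 1 + 8 / a ^ 2 * θ ^ 2 * ∫ ω, Real.exp (a * |W ω|) ∂ν := by
        rw [integral_add hi1 hi2, integral_add (integrable_const 1) (hWi.const_mul θ),
          integral_const_mul, integral_const_mul, h0]
        simp
    _ ≤ 1 + 8 / a ^ 2 * θ ^ 2 * K := by gcongr
    _ = 8 * K / a ^ 2 * θ ^ 2 + 1 := by ring
    _ ≤ _ := Real.add_one_le_exp _

lemma rf_chernoff1 {Ω : Type*} [MeasurableSpace Ω] (ν : Measure Ω) [IsProbabilityMeasure ν]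
    (W : Ω → ℝ) (θ K y : ℝ) (hθ : 0 ≤ θ)
    (hi : Integrable (fun ω => Real.exp (θ * W ω)) ν)
    (hK : ∫ ω, Real.exp (θ * W ω) ∂ν ≤ Real.exp K) (M : ℕ) :
    (Measure.pi fun _ : Fin M => ν).real {R | y ≤ ∑ l, W (R l)} ≤ Real.exp (-θ * y + M * K) := by
  have e : ∀ R : Fin M → Ω, Real.exp (θ * ∑ l, W (R l)) = ∏ l, Real.exp (θ * W (R l)) := by
    intro R; rw [Finset.mul_sum, Real.exp_sum]
  have hI : Integrable (fun R : Fin M → Ω => Real.exp (θ * ∑ l, W (R l)))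
      (Measure.pi fun _ : Fin M => ν) := by
    simp_rw [e]
    exact Integrable.fintype_prod (f := fun _ ω => Real.exp (θ * W ω)) fun _ => hi
  refine (measure_ge_le_exp_mul_mgf y hθ hI).trans ?_
  rw [mgf, Real.exp_add]
  simp_rw [e]
  rw [integral_fintype_prod_eq_pow (fun ω => Real.exp (θ * W ω)), Fintype.card_fin, Real.exp_nat_mul]
  gcongr

lemma rf_chernoff (a K : ℝ) (ha : 0 < a) (hK0 : 0 < K) :
    ∃ c : ℝ, 0 < c ∧ ∀ {Ω : Type} [MeasurableSpace Ω] (ν : Measure Ω) [IsProbabilityMeasure ν]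
    (X : Ω → ℝ), Measurable X → Integrable (fun ω => Real.exp (a * |X ω|)) ν →
    ∫ ω, Real.exp (a * |X ω|) ∂ν ≤ K → ∀ (ε : ℝ), 0 < ε → ε < 1 → ∀ (M : ℕ), 0 < M →
    (Measure.pi fun _ : Fin M => ν).real
      {R | ¬ |1 / (M : ℝ) * ∑ l, X (R l) - ∫ ω, X ω ∂ν| ≤ ε} ≤ 2 * Real.exp (-(c * (M * ε ^ 2))) := by
  set K1 := Real.exp K * K with hK1
  have hK1p : 0 < K1 := by positivity
  set K2 := 8 * K1 / a ^ 2 with hK2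
  have hK2p : 0 < K2 := by positivity
  set c1 := min (a / 2) (1 / (2 * K2)) with hc1
  have hc1p : 0 < c1 := lt_min (by positivity) (by positivity)
  refine ⟨c1 / 2, by positivity, ?_⟩
  intro Ω _ ν _ X hX hi hK ε hε hε1 M hM
  have hXi : Integrable X ν := by
    refine (hi.div_const a).mono' hX.aestronglyMeasurable (Filter.Eventually.of_forall fun ω => ?_)
    exact rf_le_exp a |X ω| ha
  set e := ∫ ω, X ω ∂ν with he
  have hea : |e| ≤ K / a := by
    calc |e| ≤ ∫ ω, |X ω| ∂ν := abs_integral_le_integral_abs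
      _ ≤ ∫ ω, Real.exp (a * |X ω|) / a ∂ν :=
        integral_mono hXi.abs (hi.div_const a) fun ω => rf_le_exp a |X ω| ha
      _ ≤ K / a := by rw [integral_div]; gcongr
  have hpt : ∀ ω, Real.exp (a * |X ω - e|) ≤ Real.exp K * Real.exp (a * |X ω|) := by
    intro ω
    rw [← Real.exp_add]
    apply Real.exp_le_exp.2
    have h1 := abs_sub (X ω) e
    have h2 : a * |e| ≤ K := by rw [le_div_iff₀ ha] at hea; linarith
    nlinarith
  have hWi : Integrable (fun ω => Real.exp (a * |X ω - e|)) ν := by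
    refine (hi.const_mul (Real.exp K)).mono' (by fun_prop) (Filter.Eventually.of_forall fun ω => ?_)
    rw [Real.norm_of_nonneg (Real.exp_pos _).le]
    exact hpt ω
  have hWK : ∫ ω, Real.exp (a * |X ω - e|) ∂ν ≤ K1 := by
    refine (integral_mono hWi (hi.const_mul (Real.exp K)) hpt).trans ?_
    rw [integral_const_mul]
    exact mul_le_mul_of_nonneg_left hK (Real.exp_pos _).le
  have hWint : Integrable (fun ω => X ω - e) ν := hXi.sub (integrable_const e)
  have hW0 : ∫ ω, (X ω - e) ∂ν = 0 := by
    rw [integral_sub hXi (integrable_const e)]; simp [he]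
  set θ := c1 * ε with hθ
  have hθ0 : 0 ≤ θ := by positivity
  have hθa : θ ≤ a / 2 := by
    have : c1 ≤ a / 2 := min_le_left _ _
    nlinarith
  have hc2 : K2 * c1 ≤ 1 / 2 := by
    have : c1 ≤ 1 / (2 * K2) := min_le_right _ _
    rw [le_div_iff₀ (by positivity)] at this
    linarith
  obtain ⟨p1, p2⟩ := rf_mgf ν (fun ω => X ω - e) (by fun_prop) a K1 θ ha
    (by rwa [abs_of_nonneg hθ0]) hWi hWK hWint hW0
  obtain ⟨q1, q2⟩ := rf_mgf ν (fun ω => X ω - e) (by fun_prop) a K1 (-θ) ha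
    (by rwa [abs_neg, abs_of_nonneg hθ0]) hWi hWK hWint hW0
  have A := rf_chernoff1 ν (fun ω => X ω - e) θ _ (M * ε) hθ0 p1 p2 M
  have B := rf_chernoff1 ν (fun ω => -(X ω - e)) θ (K2 * θ ^ 2) (M * ε) hθ0
    (by simpa only [neg_mul, mul_neg] using q1)
    (by simpa only [neg_mul, mul_neg, neg_sq, ← hK2] using q2) M
  have hMp : (0 : ℝ) < M := by exact_mod_cast hM
  have hexp : Real.exp (-θ * (M * ε) + M * (K2 * θ ^ 2)) ≤ Real.exp (-(c1 / 2 * (M * ε ^ 2))) := by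
    apply Real.exp_le_exp.2
    rw [hθ]
    have : (M * ε ^ 2 * c1) * (K2 * c1) ≤ (M * ε ^ 2 * c1) * (1 / 2) := by gcongr
    nlinarith
  have hsub : {R : Fin M → Ω | ¬ |1 / (M : ℝ) * ∑ l, X (R l) - e| ≤ ε} ⊆
      {R | M * ε ≤ ∑ l, (X (R l) - e)} ∪ {R | M * ε ≤ ∑ l, -(X (R l) - e)} := by
    intro R hR
    simp only [Set.mem_ofPred_eq, not_le, lt_abs] at hR
    have hs : ∑ l, (X (R l) - e) = M * (1 / (M : ℝ) * ∑ l, X (R l) - e) := by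
      rw [Finset.sum_sub_distrib]; simp; field_simp
    rcases hR with h | h
    · left
      simp only [Set.mem_ofPred_eq]; rw [hs]; gcongr
    · right
      simp only [Set.mem_ofPred_eq]; rw [Finset.sum_neg_distrib, hs, ← mul_neg]; gcongr
  calc _ ≤ _ := measureReal_mono hsub
    _ ≤ _ := measureReal_union_le _ _
    _ ≤ _ := add_le_add A B
    _ ≤ _ := by linarith [hexp]

instance rf_prob (d : ℕ) : IsProbabilityMeasure (_root_.stdGaussian d) := by
  unfold _root_.stdGaussian; infer_instance

lemma rf_dot_law {d : ℕ} (x : Fin d → ℝ) :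
    (_root_.stdGaussian d).map (fun r => ∑ a, x a * r a)
      = (gaussianReal 0 1).map (fun z => euclNorm x * z) := by
  have h1 := map_pi_eq_stdGaussian (ι := Fin d)
  set Lx : StrongDual ℝ (EuclideanSpace ℝ (Fin d)) := innerSL ℝ (WithLp.toLp 2 x) with hLx
  have h2 := IsGaussian.map_eq_gaussianReal (μ := ProbabilityTheory.stdGaussian
    (EuclideanSpace ℝ (Fin d))) Lx
  rw [integral_strongDual_stdGaussian, variance_dual_stdGaussian, ← h1,
    Measure.map_map (by fun_prop) (by fun_prop)] at h2
  have e1 : (Lx ∘ WithLp.toLp 2 : (Fin d → ℝ) → ℝ) = fun r => ∑ a, x a * r a := by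
    ext r
    simp [hLx, PiLp.inner_apply, mul_comm]
  rw [e1] at h2
  unfold _root_.stdGaussian
  rw [h2, gaussianReal_map_const_mul]
  congr 1
  · simp
  · have : ‖Lx‖ = euclNorm x := by
      rw [hLx, innerSL_apply_norm, EuclideanSpace.norm_eq, euclNorm]
      simp
    rw [this]
    ext
    simp [Real.coe_toNNReal _ (sq_nonneg _)]

lemma rf_pi_law {d : ℕ} (x : Fin d → ℝ) (M : ℕ) (E : Set (Fin M → ℝ)) (hE : MeasurableSet E) :
    (Measure.pi fun _ : Fin M => _root_.stdGaussian d).real {R | (fun l => ∑ a, x a * R l a) ∈ E}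
      = (Measure.pi fun _ : Fin M => gaussianReal 0 1).real {z | (fun l => euclNorm x * z l) ∈ E} := by
  have m1 : Measurable (fun r : Fin d → ℝ => ∑ a, x a * r a) := by fun_prop
  have m2 : Measurable (fun z : ℝ => euclNorm x * z) := by fun_prop
  haveI : IsProbabilityMeasure ((_root_.stdGaussian d).map (fun r => ∑ a, x a * r a)) :=
    Measure.isProbabilityMeasure_map m1.aemeasurable
  haveI : IsProbabilityMeasure ((gaussianReal 0 1).map (fun z => euclNorm x * z)) :=
    Measure.isProbabilityMeasure_map m2.aemeasurable
  have h1 := Measure.pi_map_pi (μ := fun _ : Fin M => _root_.stdGaussian d)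
    (f := fun _ r => ∑ a, x a * r a) (fun _ => m1.aemeasurable)
  have h2 := Measure.pi_map_pi (μ := fun _ : Fin M => gaussianReal 0 1)
    (f := fun _ z => euclNorm x * z) (fun _ => m2.aemeasurable)
  rw [rf_dot_law x, ← h2] at h1
  have h3 := congrArg (fun μ => μ.real E) h1
  beta_reduce at h3
  rw [map_measureReal_apply (by fun_prop) hE, map_measureReal_apply (by fun_prop) hE] at h3
  exact h3

lemma rf_integral_law {d : ℕ} (x : Fin d → ℝ) (f : ℝ → ℝ) (hf : Continuous f) :
    ∫ r, f (∑ a, x a * r a) ∂(_root_.stdGaussian d) = ∫ z, f (euclNorm x * z) ∂(gaussianReal 0 1) := by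
  have m1 : Measurable (fun r : Fin d → ℝ => ∑ a, x a * r a) := by fun_prop
  rw [← integral_map (φ := fun r : Fin d → ℝ => ∑ a, x a * r a) m1.aemeasurable
    hf.aestronglyMeasurable, rf_dot_law, integral_map (by fun_prop) hf.aestronglyMeasurable]

lemma rf_integrable_law {d : ℕ} (x : Fin d → ℝ) (f : ℝ → ℝ) (hf : Continuous f)
    (h : Integrable (fun z => f (euclNorm x * z)) (gaussianReal 0 1)) :
    Integrable (fun r : Fin d → ℝ => f (∑ a, x a * r a)) (_root_.stdGaussian d) := by
  have h2 := (integrable_map_measure (μ := gaussianReal 0 1) (f := fun z => euclNorm x * z)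
    hf.aestronglyMeasurable (by fun_prop)).2 h
  rw [← rf_dot_law] at h2
  have m1 : Measurable (fun r : Fin d → ℝ => ∑ a, x a * r a) := by fun_prop
  exact (integrable_map_measure hf.aestronglyMeasurable m1.aemeasurable).1 h2

lemma rf_small (σ : ℝ → ℝ) (H Lσ C₀ mb : ℝ) (hH : 0 < H) (hLσ : 0 ≤ Lσ) (hC₀ : 0 < C₀)
    (hσ : ∀ x y : ℝ, |σ x - σ y| ≤ Lσ * |x - y|) (hσB : ∀ z : ℝ, |σ z| ≤ C₀ * (1 + |z|))
    {d : ℕ} (x : Fin d → ℝ) (hx : euclNorm x ≤ H)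
    (hint : Integrable (fun z => σ (euclNorm x * z) ^ 2) (gaussianReal 0 1))
    (hmb : ∫ z, σ (euclNorm x * z) ^ 2 ∂(gaussianReal 0 1) ≤ mb)
    (ε : ℝ) (hε : 0 < ε) (hε1 : ε < 1) (M : ℕ) (hM : 0 < M) :
    M * ε ^ 2 * (Measure.pi fun _ : Fin M => _root_.stdGaussian d).real
      {R | ¬ |1 / (M : ℝ) * ∑ l, σ (∑ a, x a * R l a) * σ (∑ a, x a * R l a)
        - ∫ r, σ (∑ a, x a * r a) * σ (∑ a, x a * r a) ∂(_root_.stdGaussian d)| ≤ ε} ≤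
    (((Lσ * H) * (2 * (C₀ * (1 + H)) + 1) * (4 * Real.exp 1) * (2 + mb + 2 * (Lσ * H) ^ 2))
      * (2 + mb) + 1) *
    (1 - (Measure.pi fun _ : Fin M => _root_.stdGaussian d).real
      {R | ¬ |1 / (M : ℝ) * ∑ l, σ (∑ a, x a * R l a) * σ (∑ a, x a * R l a)
        - ∫ r, σ (∑ a, x a * r a) * σ (∑ a, x a * r a) ∂(_root_.stdGaussian d)| ≤ ε}) := by
  obtain ⟨n, rfl⟩ : ∃ n, M = n + 1 := ⟨M - 1, by omega⟩
  have hσc := rf_lip_cont hLσ hσ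
  have hs0 : 0 ≤ euclNorm x := Real.sqrt_nonneg _
  set s := euclNorm x with hs
  set m := ∫ z, σ (s * z) ^ 2 ∂(gaussianReal 0 1) with hm
  have hm0 : 0 ≤ m := integral_nonneg fun z => sq_nonneg _
  have hk : ∫ r, σ (∑ a, x a * r a) * σ (∑ a, x a * r a) ∂(_root_.stdGaussian d) = m := by
    simp_rw [← pow_two]
    exact rf_integral_law x (fun t => σ t ^ 2) (by fun_prop)
  rw [hk]
  simp_rw [← pow_two]
  set E : Set (Fin (n + 1) → ℝ) :=
    {w | |1 / ((n + 1 : ℕ) : ℝ) * ∑ l, σ (w l) ^ 2 - m| ≤ ε} with hE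
  have hEm : MeasurableSet E := (isClosed_le (by fun_prop) (by fun_prop)).measurableSet
  have h1 := rf_pi_law x (n + 1) Eᶜ hEm.compl
  have hgap := rf_gap (fun z => σ (s * z)) (Lσ * H) (C₀ * (1 + H)) ε (by positivity) (by positivity)
    hε (fun p q => by
      refine (hσ _ _).trans ?_
      rw [← mul_sub, abs_mul, abs_of_nonneg hs0, mul_assoc]
      gcongr) (fun z => by
      refine (hσB _).trans ?_
      rw [abs_mul, abs_of_nonneg hs0, mul_assoc]
      gcongr
      have := abs_nonneg z
      nlinarith [mul_le_mul_of_nonneg_right hx this]) m hm hint n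
  have hGm : MeasurableSet {z : Fin (n + 1) → ℝ |
      |1 / ((n + 1 : ℕ) : ℝ) * ∑ l, σ (s * z l) ^ 2 - m| ≤ ε} :=
    (isClosed_le (by fun_prop) (by fun_prop)).measurableSet
  have h2 := probReal_compl_eq_one_sub (μ := Measure.pi fun _ : Fin (n + 1) => gaussianReal 0 1) hGm
  set G := (Measure.pi fun _ : Fin (n + 1) => gaussianReal 0 1).real {z : Fin (n + 1) → ℝ |
      |1 / ((n + 1 : ℕ) : ℝ) * ∑ l, σ (s * z l) ^ 2 - m| ≤ ε} with hG
  have h3 : (Measure.pi fun _ : Fin (n + 1) => _root_.stdGaussian d).real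
      {R | ¬ |1 / ((n + 1 : ℕ) : ℝ) * ∑ l, σ (∑ a, x a * R l a) ^ 2 - m| ≤ ε} = 1 - G :=
    h1.trans h2
  rw [h3]
  have hmb0 : 0 ≤ mb := hm0.trans hmb
  have hG0 : 0 ≤ G := measureReal_nonneg
  have hMp : (0 : ℝ) < ((n + 1 : ℕ) : ℝ) := by positivity
  calc ((n + 1 : ℕ) : ℝ) * ε ^ 2 * (1 - G) = ((n + 1 : ℕ) : ℝ) * (ε ^ 2 * (1 - G)) := by ring
    _ ≤ ((n + 1 : ℕ) : ℝ) * _ := mul_le_mul_of_nonneg_left hgap hMp.le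
    _ = ((Lσ * H) * (2 * (C₀ * (1 + H)) + 1) * (4 * Real.exp 1) * (2 + m + 2 * (Lσ * H) ^ 2))
        * (1 + m + ε) * G := by field_simp
    _ ≤ (((Lσ * H) * (2 * (C₀ * (1 + H)) + 1) * (4 * Real.exp 1) * (2 + mb + 2 * (Lσ * H) ^ 2))
        * (1 + mb + 1) + 1) * G := by
      refine mul_le_mul_of_nonneg_right ?_ hG0
      refine le_trans ?_ (le_add_of_nonneg_right zero_le_one)
      gcongr
    _ = _ := by ring

lemma rf_expmom (H C₀ : ℝ) (hH : 0 < H) (hC₀ : 0 < C₀) :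
    ∃ a K : ℝ, 0 < a ∧ 0 < K ∧ ∀ (σ : ℝ → ℝ), Continuous σ →
      (∀ z : ℝ, |σ z| ≤ C₀ * (1 + |z|)) → ∀ s : ℝ, 0 ≤ s → s ≤ H →
      Integrable (fun z => Real.exp (a * σ (s * z) ^ 2)) (gaussianReal 0 1) ∧
      ∫ z, Real.exp (a * σ (s * z) ^ 2) ∂(gaussianReal 0 1) ≤ K := by
  obtain ⟨α, hα, hi⟩ := IsGaussian.exists_integrable_exp_sq (gaussianReal 0 1)
  set B := C₀ * (1 + H) with hB
  have hBp : 0 < B := by positivity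
  refine ⟨α / (2 * B ^ 2), Real.exp α * ∫ z, Real.exp (α * ‖z‖ ^ 2) ∂(gaussianReal 0 1),
    by positivity, mul_pos (Real.exp_pos _) (integral_exp_pos hi), ?_⟩
  intro σ hσc hσB s hs0 hsH
  have hpt : ∀ z, Real.exp (α / (2 * B ^ 2) * σ (s * z) ^ 2) ≤
      Real.exp α * Real.exp (α * ‖z‖ ^ 2) := by
    intro z
    rw [← Real.exp_add]
    apply Real.exp_le_exp.2
    have h1 : |σ (s * z)| ≤ B * (1 + |z|) := by
      refine (hσB _).trans ?_
      rw [abs_mul, abs_of_nonneg hs0, hB, mul_assoc]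
      gcongr
      have := abs_nonneg z
      nlinarith [mul_le_mul_of_nonneg_right hsH this]
    have h2 : σ (s * z) ^ 2 ≤ B ^ 2 * (2 * (1 + |z| ^ 2)) := by
      rw [← sq_abs (σ _)]
      calc |σ (s * z)| ^ 2 ≤ (B * (1 + |z|)) ^ 2 := by gcongr
        _ = B ^ 2 * (1 + |z|) ^ 2 := by ring
        _ ≤ _ := by gcongr; nlinarith [sq_nonneg (1 - |z|)]
    calc α / (2 * B ^ 2) * σ (s * z) ^ 2 ≤ α / (2 * B ^ 2) * (B ^ 2 * (2 * (1 + |z| ^ 2))) := by gcongr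
      _ = α + α * ‖z‖ ^ 2 := by rw [Real.norm_eq_abs]; field_simp
  have hint : Integrable (fun z => Real.exp (α / (2 * B ^ 2) * σ (s * z) ^ 2)) (gaussianReal 0 1) := by
    refine (hi.const_mul (Real.exp α)).mono' ?_ (Filter.Eventually.of_forall fun z => ?_)
    · exact (by fun_prop : Continuous _).aestronglyMeasurable
    · rw [Real.norm_of_nonneg (Real.exp_pos _).le]; exact hpt z
  refine ⟨hint, ?_⟩
  rw [← integral_const_mul]
  exact integral_mono hint (hi.const_mul _) hpt

lemma rf_exp_amgm (a p q : ℝ) (ha : 0 < a) :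
    Real.exp (a * |p * q|) ≤ (Real.exp (a * p ^ 2) + Real.exp (a * q ^ 2)) / 2 := by
  have h1 : |p * q| ≤ (p ^ 2 + q ^ 2) / 2 := by
    rw [abs_mul, ← sq_abs p, ← sq_abs q]
    nlinarith [sq_nonneg (|p| - |q|)]
  have h2 : Real.exp (a * |p * q|) ≤ Real.exp (a * p ^ 2 / 2) * Real.exp (a * q ^ 2 / 2) := by
    rw [← Real.exp_add]
    apply Real.exp_le_exp.2
    have := mul_le_mul_of_nonneg_left h1 ha.le
    linarith
  have e1 : Real.exp (a * p ^ 2) = Real.exp (a * p ^ 2 / 2) ^ 2 := by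
    rw [← Real.exp_nat_mul]; congr 1; push_cast; ring
  have e2 : Real.exp (a * q ^ 2) = Real.exp (a * q ^ 2 / 2) ^ 2 := by
    rw [← Real.exp_nat_mul]; congr 1; push_cast; ring
  rw [e1, e2]
  refine h2.trans ?_
  have := sq_nonneg (Real.exp (a * p ^ 2 / 2) - Real.exp (a * q ^ 2 / 2))
  linarith [sub_sq (Real.exp (a * p ^ 2 / 2)) (Real.exp (a * q ^ 2 / 2))]

set_option maxHeartbeats 1000000 in
/-- **Random-feature kernel concentration (Lemma B.1).**
For an `L_σ`-Lipschitz activation `σ` with linear growth `|σ(z)| ≤ C₀(1+|z|)`,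
embeddings `h_1,…,h_N` with `‖h_i‖₂ ≤ H`, and the kernel
`k(h,h') = E_{r∼N(0,I_d)}[σ(hᵀr)σ(h'ᵀr)]`, there is a constant `C_rf > 0`
depending only on `H, L_σ, C₀` such that whenever `M ≥ C_rf log(N²/δ)/ε²`, with
probability at least `1 − δ` over a `d×M` matrix `R` with i.i.d. standard normal
entries (columns `r_1,…,r_M`),
`max_{i,j} |(1/M) Σ_ℓ σ(h_iᵀ r_ℓ) σ(h_jᵀ r_ℓ) − k(h_i,h_j)| ≤ ε`. -/
theorem random_feature_kernel_concentration
    (H Lσ C₀ : ℝ) (hH : 0 < H) (hLσ : 0 ≤ Lσ) (hC₀ : 0 < C₀) :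
    ∃ Crf : ℝ, 0 < Crf ∧
      ∀ (σ : ℝ → ℝ),
        (∀ x y : ℝ, |σ x - σ y| ≤ Lσ * |x - y|) →
        (∀ z : ℝ, |σ z| ≤ C₀ * (1 + |z|)) →
        ∀ (d N : ℕ), 0 < d → 0 < N →
        ∀ (h : Fin N → Fin d → ℝ), (∀ i, euclNorm (h i) ≤ H) →
        ∀ (k : (Fin d → ℝ) → (Fin d → ℝ) → ℝ),
          (∀ x y : Fin d → ℝ,
            k x y = ∫ r, σ (∑ a, x a * r a) * σ (∑ a, y a * r a) ∂(stdGaussian d)) →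
        ∀ (δ ε : ℝ), δ ∈ Set.Ioo (0 : ℝ) 1 → ε ∈ Set.Ioo (0 : ℝ) 1 →
        ∀ (M : ℕ), Crf * Real.log ((N : ℝ) ^ 2 / δ) / ε ^ 2 ≤ (M : ℝ) →
          ((Measure.pi fun _ : Fin M => stdGaussian d)
              {R : Fin M → Fin d → ℝ | ∀ i j : Fin N,
                |(1 / (M : ℝ)) * ∑ ℓ : Fin M,
                    σ (∑ a, h i a * R ℓ a) * σ (∑ a, h j a * R ℓ a)
                  - k (h i) (h j)| ≤ ε}).toReal ≥ 1 - δ := by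

  obtain ⟨a, K, ha, hK, hmom⟩ := rf_expmom H C₀ hH hC₀
  obtain ⟨c, hc, hch⟩ := rf_chernoff a K ha hK
  set C1 := ((Lσ * H) * (2 * (C₀ * (1 + H)) + 1) * (4 * Real.exp 1)
    * (2 + K / a + 2 * (Lσ * H) ^ 2)) * (2 + K / a) + 1 with hC1
  have hC1p : 0 < C1 := by positivity
  have hlog2 : 0 < Real.log 2 := Real.log_pos one_lt_two
  set A0 := 2 * Real.log 2 / c with hA0
  have hA0p : 0 < A0 := by positivity
  refine ⟨2 / c + (C1 + A0), by positivity, ?_⟩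
  intro σ hσ hσB d N hd hN h hh k hk δ ε hδ hε M hMb
  obtain ⟨hδ0, hδ1⟩ := hδ
  obtain ⟨hε0, hε1⟩ := hε
  have hσc := rf_lip_cont hLσ hσ
  have hN1 : (1 : ℝ) ≤ N := by exact_mod_cast hN
  set Λ := Real.log ((N : ℝ) ^ 2 / δ) with hΛ
  have hΛp : 0 < Λ := by
    apply Real.log_pos
    rw [lt_div_iff₀ hδ0]
    nlinarith
  have hMpos : (0 : ℝ) < M := lt_of_lt_of_le (by positivity) hMb
  have hM : 0 < M := by exact_mod_cast hMpos
  have hMε : (2 / c + (C1 + A0)) * Λ ≤ M * ε ^ 2 := by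
    rwa [div_le_iff₀ (by positivity)] at hMb
  have hMε1 : 2 * Λ ≤ c * (M * ε ^ 2) := by
    have h1 : 2 / c * Λ ≤ M * ε ^ 2 := by
      refine le_trans ?_ hMε
      gcongr
      linarith
    rw [div_mul_eq_mul_div, div_le_iff₀ hc] at h1
    linarith
  have hMε2 : (C1 + A0) * Λ ≤ M * ε ^ 2 := by
    refine le_trans (mul_le_mul_of_nonneg_right ?_ hΛp.le) hMε
    have : 0 < 2 / c := by positivity
    linarith
  set μ := Measure.pi fun _ : Fin M => _root_.stdGaussian d with hμ
  set bad : Fin N → Fin N → Set (Fin M → Fin d → ℝ) := fun i j =>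
    {R | ¬ |1 / (M : ℝ) * ∑ l, σ (∑ a, h i a * R l a) * σ (∑ a, h j a * R l a)
        - k (h i) (h j)| ≤ ε} with hbad
  have hs0 : ∀ i, 0 ≤ euclNorm (h i) := fun i => Real.sqrt_nonneg _
  have hI1 : ∀ i, Integrable (fun r : Fin d → ℝ => Real.exp (a * σ (∑ b, h i b * r b) ^ 2))
      (_root_.stdGaussian d) := fun i =>
    rf_integrable_law (h i) (fun t => Real.exp (a * σ t ^ 2)) (by fun_prop)
      (hmom σ hσc hσB _ (hs0 i) (hh i)).1
  have hI2 : ∀ i, ∫ r : Fin d → ℝ, Real.exp (a * σ (∑ b, h i b * r b) ^ 2)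
      ∂(_root_.stdGaussian d) ≤ K := fun i => by
    rw [rf_integral_law (h i) (fun t => Real.exp (a * σ t ^ 2)) (by fun_prop)]
    exact (hmom σ hσc hσB _ (hs0 i) (hh i)).2
  have hpair : ∀ i j, μ.real (bad i j) ≤ 2 * Real.exp (-(c * (M * ε ^ 2))) := by
    intro i j
    have hpt : ∀ r : Fin d → ℝ,
        Real.exp (a * |σ (∑ b, h i b * r b) * σ (∑ b, h j b * r b)|) ≤
        (Real.exp (a * σ (∑ b, h i b * r b) ^ 2) + Real.exp (a * σ (∑ b, h j b * r b) ^ 2)) / 2 := by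
      exact fun r => rf_exp_amgm a _ _ ha
    have hXc : Continuous fun r : Fin d → ℝ => σ (∑ b, h i b * r b) * σ (∑ b, h j b * r b) := by
      fun_prop
    have hbi : Integrable (fun r : Fin d → ℝ =>
        (Real.exp (a * σ (∑ b, h i b * r b) ^ 2) + Real.exp (a * σ (∑ b, h j b * r b) ^ 2)) / 2)
        (_root_.stdGaussian d) := ((hI1 i).add (hI1 j)).div_const 2
    have hXi : Integrable (fun r : Fin d → ℝ =>
        Real.exp (a * |σ (∑ b, h i b * r b) * σ (∑ b, h j b * r b)|)) (_root_.stdGaussian d) := by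
      refine hbi.mono' ?_ (Filter.Eventually.of_forall fun r => ?_)
      · exact (by fun_prop : Continuous _).aestronglyMeasurable
      · rw [Real.norm_of_nonneg (Real.exp_pos _).le]; exact hpt r
    have hXK : ∫ r : Fin d → ℝ, Real.exp (a * |σ (∑ b, h i b * r b) * σ (∑ b, h j b * r b)|)
        ∂(_root_.stdGaussian d) ≤ K := by
      refine (integral_mono hXi hbi hpt).trans ?_
      rw [integral_div, integral_add (hI1 i) (hI1 j)]
      linarith [hI2 i, hI2 j]
    have := hch (_root_.stdGaussian d) _ hXc.measurable hXi hXK ε hε0 hε1 M hM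
    simp only [hbad]
    rw [hk]
    exact this
  have hgood : {R : Fin M → Fin d → ℝ | ∀ i j : Fin N,
      |(1 / (M : ℝ)) * ∑ ℓ : Fin M,
        σ (∑ a, h i a * R ℓ a) * σ (∑ a, h j a * R ℓ a) - k (h i) (h j)| ≤ ε}
      = (⋃ i ∈ (Finset.univ : Finset (Fin N)), ⋃ j ∈ (Finset.univ : Finset (Fin N)), bad i j)ᶜ := by
    ext R; simp [hbad]
  have hbm : ∀ i j, MeasurableSet (bad i j) := fun i j =>
    (isClosed_le (f := fun R : Fin M → Fin d → ℝ =>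
      |1 / (M : ℝ) * ∑ l, σ (∑ a, h i a * R l a) * σ (∑ a, h j a * R l a)
        - k (h i) (h j)|) (g := fun _ => ε) (by fun_prop) (by fun_prop)).measurableSet.compl
  have hUm : MeasurableSet
      (⋃ i ∈ (Finset.univ : Finset (Fin N)), ⋃ j ∈ (Finset.univ : Finset (Fin N)), bad i j) :=
    Finset.measurableSet_biUnion _ fun i _ => Finset.measurableSet_biUnion _ fun j _ => hbm i j
  rw [hgood]
  change μ.real _ ≥ 1 - δ
  rw [probReal_compl_eq_one_sub hUm]
  suffices hsuff : μ.real
      (⋃ i ∈ (Finset.univ : Finset (Fin N)), ⋃ j ∈ (Finset.univ : Finset (Fin N)), bad i j) ≤ δ by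
    linarith
  have hsum : μ.real
      (⋃ i ∈ (Finset.univ : Finset (Fin N)), ⋃ j ∈ (Finset.univ : Finset (Fin N)), bad i j)
      ≤ ∑ i, ∑ j, μ.real (bad i j) :=
    (measureReal_biUnion_finset_le _ _).trans
      (Finset.sum_le_sum fun i _ => measureReal_biUnion_finset_le _ _)
  refine hsum.trans ?_
  have hexpΛ : Real.exp (-Λ) = δ / (N : ℝ) ^ 2 := by
    rw [Real.exp_neg, hΛ, Real.exp_log (by positivity), inv_div]
  rcases Nat.lt_or_ge 1 N with hN2 | hN2
  · have hN2' : (2 : ℝ) ≤ N := by exact_mod_cast hN2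
    calc ∑ i, ∑ j, μ.real (bad i j)
        ≤ ∑ i : Fin N, ∑ j : Fin N, 2 * Real.exp (-(c * (M * ε ^ 2))) :=
          Finset.sum_le_sum fun i _ => Finset.sum_le_sum fun j _ => hpair i j
      _ = (N : ℝ) ^ 2 * (2 * Real.exp (-(c * (M * ε ^ 2)))) := by simp; ring
      _ ≤ (N : ℝ) ^ 2 * (2 * (Real.exp (-Λ) * Real.exp (-Λ))) := by
          rw [← Real.exp_add]
          gcongr
          linarith
      _ = δ * (2 * δ / (N : ℝ) ^ 2) := by rw [hexpΛ]; field_simp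
      _ ≤ δ * 1 := by
          gcongr
          rw [div_le_one (by positivity)]
          nlinarith
      _ = δ := mul_one δ
  · obtain rfl : N = 1 := by omega
    simp only [Finset.univ_unique, Finset.sum_singleton]
    set i₀ : Fin 1 := default
    have hexpΛ' : Real.exp (-Λ) = δ := by rw [hexpΛ]; simp
    rcases le_or_gt A0 (M * ε ^ 2) with hA | hA
    · refine (hpair i₀ i₀).trans ?_
      rw [← hexpΛ']
      have h1 : 2 * Real.log 2 ≤ c * (M * ε ^ 2) := by
        rw [hA0, div_le_iff₀ hc] at hA
        linarith
      calc 2 * Real.exp (-(c * (M * ε ^ 2)))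
          = Real.exp (Real.log 2 + -(c * (M * ε ^ 2))) := by
            rw [Real.exp_add, Real.exp_log two_pos]
        _ ≤ _ := Real.exp_le_exp.2 (by linarith)
    · have hint2 : Integrable (fun z => σ (euclNorm (h i₀) * z) ^ 2) (gaussianReal 0 1) := by
        refine ((hmom σ hσc hσB _ (hs0 i₀) (hh i₀)).1.div_const a).mono' ?_
          (Filter.Eventually.of_forall fun z => ?_)
        · exact (by fun_prop : Continuous _).aestronglyMeasurable
        · rw [Real.norm_of_nonneg (sq_nonneg _)]; exact rf_le_exp a _ ha
      have hmb : ∫ z, σ (euclNorm (h i₀) * z) ^ 2 ∂(gaussianReal 0 1) ≤ K / a := by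
        refine (integral_mono hint2 ((hmom σ hσc hσB _ (hs0 i₀) (hh i₀)).1.div_const a)
          fun z => rf_le_exp a _ ha).trans ?_
        rw [integral_div]
        have := (hmom σ hσc hσB _ (hs0 i₀) (hh i₀)).2
        gcongr
      have hsm := rf_small σ H Lσ C₀ (K / a) hH hLσ hC₀ hσ hσB (h i₀) (hh i₀) hint2 hmb ε hε0 hε1 M hM
      rw [← hk, ← hC1] at hsm
      change M * ε ^ 2 * μ.real (bad i₀ i₀) ≤ C1 * (1 - μ.real (bad i₀ i₀)) at hsm
      set p := μ.real (bad i₀ i₀)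
      set y := (M : ℝ) * ε ^ 2 with hy
      have hy0 : 0 < y := by positivity
      have hp : p ≤ C1 / (C1 + y) := by
        rw [le_div_iff₀ (by positivity)]; linarith
      refine hp.trans ?_
      rw [← hexpΛ', div_le_iff₀ (by positivity)]
      -- C1 ≤ exp(-Λ) (C1 + y)
      have h1 := Real.add_one_le_exp (-Λ)
      have h2 : Λ * (C1 + y) ≤ y := by
        have := mul_le_mul_of_nonneg_left hA.le hΛp.le
        linarith
      have h3 := mul_le_mul_of_nonneg_right h1 (by positivity : 0 ≤ C1 + y)
      linarith
end
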